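/- (a) If there exists n ≥ 0 such that Sₙ(t) is a compact operator for every t > 0, or such that Rₙ(t) is a compact operator for every t > 0, then ω_ess(R₀) = ω_ess(T₀). (b) If there exists n ≥ 0 such that Sₙ is norm continuous on (0,∞), or such that Rₙ is norm continuous on (0,∞), then ℓ^∞_{R₀}(X₀) = ℓ^∞_{T₀}(X₀), the induced quotient operators R̂₀(t) and T̂₀(t) are defined, and ω_crit(R₀) = ω_crit(T₀). -/

import Mathlib

open Set Filter MeasureTheory
open scoped Topology

noncomputable section

structure MRSetting (X : Type*) [NormedAddCommGroup X] [NormedSpace ℂ X] [CompleteSpace X]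
    (X₀ : Submodule ℂ X) where
  closed : IsClosed (X₀ : Set X)
  T : ℝ → (X₀ →L[ℂ] X₀)
  S : ℝ → (X →L[ℂ] X₀)
  T_zero : T 0 = 1
  T_add : ∀ t s : ℝ, 0 ≤ t → 0 ≤ s → T (t + s) = (T t).comp (T s)
  T_cont : ∀ x : X₀, ContinuousOn (fun t => T t x) (Ici 0)
  S_zero : S 0 = 0
  S_cont : ∀ x : X, ContinuousOn (fun t => S t x) (Ici 0)
  TS : ∀ t s : ℝ, 0 ≤ t → 0 ≤ s → ∀ x : X, T t (S s x) = S (t + s) x - S t x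
  δ : ℝ → ℝ
  δ_nonneg : ∀ t : ℝ, 0 ≤ t → 0 ≤ δ t
  δ_mono : MonotoneOn δ (Ici 0)
  δ_lim : Tendsto δ (𝓝[>] 0) (𝓝 0)
  SD : (ℝ → X) → ℝ → X₀
  SD_deriv : ∀ f : ℝ → X, ContinuousOn f (Ici 0) → ∀ t ∈ Ici (0:ℝ),
    HasDerivWithinAt (fun τ : ℝ => ∫ s in (0:ℝ)..τ, S (τ - s) (f s)) (SD f t) (Ici 0) t
  SD_cont : ∀ f : ℝ → X, ContinuousOn f (Ici 0) → ContinuousOn (SD f) (Ici 0)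
  SD_bound : ∀ f : ℝ → X, ContinuousOn f (Ici 0) → ∀ t ∈ Ici (0:ℝ),
    ‖SD f t‖ ≤ δ t * ⨆ s : Icc (0:ℝ) t, ‖f (s : ℝ)‖
  SDop : (ℝ → (X₀ →L[ℂ] X)) → ℝ → (X₀ →L[ℂ] X₀)
  SDop_apply : ∀ V : ℝ → (X₀ →L[ℂ] X), (∀ x : X₀, ContinuousOn (fun s => V s x) (Ici 0)) →
    ∀ t : ℝ, ∀ x : X₀, SDop V t x = SD (fun s => V s x) t

variable {X : Type*} [NormedAddCommGroup X] [NormedSpace ℂ X] [CompleteSpace X]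
  {X₀ : Submodule ℂ X}

/-- The perturbation operator `B(U) = S ⋄ (L ∘ U)`. -/
def MRSetting.Bop (M : MRSetting X X₀) (L : X₀ →L[ℂ] X) (U : ℝ → (X₀ →L[ℂ] X₀)) :
    ℝ → (X₀ →L[ℂ] X₀) :=
  M.SDop (fun s => L.comp (U s))


/-- The essential growth bound of an operator family `W`, defined through the operator-norm
distance from `W t` to the compact operators. -/
def omegaEss (W : ℝ → (X₀ →L[ℂ] X₀)) : EReal :=
  sInf ((fun w : ℝ => (w : EReal)) ''
    {w : ℝ | ∃ C : ℝ, 0 ≤ C ∧ ∀ t : ℝ, 0 ≤ t →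
      Metric.infDist (W t) {K : X₀ →L[ℂ] X₀ | IsCompactOperator ⇑K} ≤ C * Real.exp (w * t)})

/-- The operator induced on `ℓ^∞(X₀)` (bounded sequences in `X₀`) by coordinatewise
application of a bounded operator. -/
def seqOp (W : X₀ →L[ℂ] X₀) :
    BoundedContinuousFunction ℕ X₀ →L[ℂ] BoundedContinuousFunction ℕ X₀ :=
  W.compLeftContinuousBounded ℕ

/-- The subspace `ℓ^∞_W(X₀)` of strong continuity of the extension of `W` to `ℓ^∞(X₀)`:
those bounded sequences `x` with `sup_n ‖W(t) xₙ − xₙ‖ → 0` as `t → 0⁺`. -/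
def critSub (W : ℝ → (X₀ →L[ℂ] X₀)) : Submodule ℂ (BoundedContinuousFunction ℕ X₀) where
  carrier := {x | Tendsto (fun t : ℝ => seqOp (W t) x) (𝓝[>] 0) (𝓝 x)}
  add_mem' := by
    intro a b ha hb
    simp only [Set.mem_setOf_eq, map_add] at ha hb ⊢
    exact Tendsto.add ha hb
  zero_mem' := by
    simp only [Set.mem_setOf_eq, map_zero]
    exact tendsto_const_nhds
  smul_mem' := by
    intro c x hx
    simp only [Set.mem_setOf_eq, _root_.map_smul] at hx ⊢
    exact Tendsto.const_smul hx c

/-- The critical growth bound of an operator family `W`: the growth bound of the operators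
induced by `W` on the quotient `ℓ^∞(X₀)/ℓ^∞_W(X₀)`, expressed via the quotient norm
`‖[x]‖ = infDist x ℓ^∞_W(X₀)`. -/
def omegaCrit (W : ℝ → (X₀ →L[ℂ] X₀)) : EReal :=
  sInf ((fun w : ℝ => (w : EReal)) ''
    {w : ℝ | ∃ C : ℝ, 0 ≤ C ∧ ∀ t : ℝ, 0 ≤ t → ∀ x : BoundedContinuousFunction ℕ X₀,
      Metric.infDist (seqOp (W t) x) (critSub W : Set (BoundedContinuousFunction ℕ X₀)) ≤
        C * Real.exp (w * t) *
          Metric.infDist x (critSub W : Set (BoundedContinuousFunction ℕ X₀))})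


set_option linter.unusedSectionVars false
set_option linter.unusedVariables false

/-- The same data with the subspace replaced by an abstract Banach space `Y`. -/
structure GS (X Y : Type*) [NormedAddCommGroup X] [NormedSpace ℂ X] [CompleteSpace X]
    [NormedAddCommGroup Y] [NormedSpace ℂ Y] [CompleteSpace Y] where
  T : ℝ → (Y →L[ℂ] Y)
  S : ℝ → (X →L[ℂ] Y)
  T_zero : T 0 = 1
  T_add : ∀ t s : ℝ, 0 ≤ t → 0 ≤ s → T (t + s) = (T t).comp (T s)
  T_cont : ∀ x : Y, ContinuousOn (fun t => T t x) (Ici 0)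
  S_zero : S 0 = 0
  S_cont : ∀ x : X, ContinuousOn (fun t => S t x) (Ici 0)
  TS : ∀ t s : ℝ, 0 ≤ t → 0 ≤ s → ∀ x : X, T t (S s x) = S (t + s) x - S t x
  δ : ℝ → ℝ
  δ_nonneg : ∀ t : ℝ, 0 ≤ t → 0 ≤ δ t
  δ_mono : MonotoneOn δ (Ici 0)
  δ_lim : Tendsto δ (𝓝[>] 0) (𝓝 0)
  SD : (ℝ → X) → ℝ → Y
  SD_deriv : ∀ f : ℝ → X, ContinuousOn f (Ici 0) → ∀ t ∈ Ici (0:ℝ),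
    HasDerivWithinAt (fun τ : ℝ => ∫ s in (0:ℝ)..τ, S (τ - s) (f s)) (SD f t) (Ici 0) t
  SD_cont : ∀ f : ℝ → X, ContinuousOn f (Ici 0) → ContinuousOn (SD f) (Ici 0)
  SD_bound : ∀ f : ℝ → X, ContinuousOn f (Ici 0) → ∀ t ∈ Ici (0:ℝ),
    ‖SD f t‖ ≤ δ t * ⨆ s : Icc (0:ℝ) t, ‖f (s : ℝ)‖
  SDop : (ℝ → (Y →L[ℂ] X)) → ℝ → (Y →L[ℂ] Y)
  SDop_apply : ∀ V : ℝ → (Y →L[ℂ] X), (∀ x : Y, ContinuousOn (fun s => V s x) (Ici 0)) →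
    ∀ t : ℝ, ∀ x : Y, SDop V t x = SD (fun s => V s x) t

variable {Y : Type*} [NormedAddCommGroup Y] [NormedSpace ℂ Y] [CompleteSpace Y]

/-- The perturbation operator. -/
def GS.Bop (M : GS X Y) (L : Y →L[ℂ] X) (U : ℝ → (Y →L[ℂ] Y)) : ℝ → (Y →L[ℂ] Y) :=
  M.SDop (fun s => L.comp (U s))

section generic

variable {F G : Type*} [NormedAddCommGroup F] [NormedSpace ℂ F] [NormedAddCommGroup G]
  [NormedSpace ℂ G]

lemma locBdd [CompleteSpace F] (U : ℝ → F →L[ℂ] G)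
    (h : ∀ x, ContinuousOn (fun t => U t x) (Ici 0)) (b : ℝ) :
    ∃ C, 0 ≤ C ∧ ∀ t, 0 ≤ t → t ≤ b → ‖U t‖ ≤ C := by
  have key : ∀ x, ∃ C, ∀ i : Icc (0:ℝ) b, ‖U i x‖ ≤ C := by
    intro x
    obtain ⟨C, hC⟩ := isCompact_Icc.exists_bound_of_continuousOn
      ((h x).mono (Icc_subset_Ici_self : Icc (0:ℝ) b ⊆ Ici 0))
    exact ⟨C, fun i => hC i i.2⟩
  obtain ⟨C, hC⟩ := banach_steinhaus (g := fun i : Icc (0:ℝ) b => U i) key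
  exact ⟨max C 0, le_max_right _ _, fun t h0 h1 => (hC ⟨t, h0, h1⟩).trans (le_max_left _ _)⟩

lemma jointCont [CompleteSpace F] (U : ℝ → F →L[ℂ] G)
    (h : ∀ x, ContinuousOn (fun t => U t x) (Ici 0)) :
    ContinuousOn (fun p : ℝ × F => U p.1 p.2) (Ici 0 ×ˢ univ) := by
  rintro ⟨t0, y0⟩ ⟨ht0, -⟩
  obtain ⟨C, hC0, hC⟩ := locBdd U h (t0 + 1)
  have h1 : Tendsto (fun p : ℝ × F => U p.1 y0) (𝓝[Ici 0 ×ˢ univ] (t0, y0)) (𝓝 (U t0 y0)) := by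
    have := h y0 t0 ht0
    refine Tendsto.comp this ?_
    refine tendsto_nhdsWithin_iff.2 ⟨?_, ?_⟩
    · exact (continuous_fst.tendsto (t0, y0)).mono_left nhdsWithin_le_nhds
    · filter_upwards [self_mem_nhdsWithin] with p hp using hp.1
  have h2 : Tendsto (fun p : ℝ × F => U p.1 (p.2 - y0)) (𝓝[Ici 0 ×ˢ univ] (t0, y0)) (𝓝 0) := by
    have h3 : Tendsto (fun p : ℝ × F => C * ‖p.2 - y0‖) (𝓝[Ici 0 ×ˢ univ] (t0, y0)) (𝓝 0) := by
      have : Continuous (fun p : ℝ × F => C * ‖p.2 - y0‖) := by fun_prop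
      have h4 := (this.tendsto (t0, y0)).mono_left (nhdsWithin_le_nhds (s := Ici 0 ×ˢ univ))
      simpa using h4
    refine squeeze_zero_norm' ?_ h3
    have h5 : ∀ᶠ p : ℝ × F in 𝓝[Ici 0 ×ˢ univ] (t0, y0), p.1 < t0 + 1 := by
      apply nhdsWithin_le_nhds
      exact (continuous_fst.tendsto (t0, y0)).eventually (gt_mem_nhds (by simp))
    filter_upwards [h5, self_mem_nhdsWithin] with p hp hp2
    exact (U p.1).le_of_opNorm_le (hC _ hp2.1 hp.le) _
  have := h2.add h1
  simpa [ContinuousWithinAt] using this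

lemma jointCont_comp [CompleteSpace F] (U : ℝ → F →L[ℂ] G)
    (h : ∀ x, ContinuousOn (fun t => U t x) (Ici 0)) {s : Set ℝ} {a : ℝ → ℝ} {f : ℝ → F}
    (ha : ContinuousOn a s) (ha' : ∀ x ∈ s, 0 ≤ a x) (hf : ContinuousOn f s) :
    ContinuousOn (fun x => U (a x) (f x)) s :=
  (jointCont U h).comp (ha.prodMk hf) (fun x hx => ⟨ha' x hx, mem_univ _⟩)

lemma slope_right [NormedSpace ℝ G] {f : ℝ → G} {f' : G} {t : ℝ}
    (h : HasDerivWithinAt f f' (Ioi t) t) :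
    Tendsto (fun h : ℝ => h⁻¹ • (f (t + h) - f t)) (𝓝[>] 0) (𝓝 f') := by
  rw [hasDerivWithinAt_iff_tendsto_slope' (by simp)] at h
  have h2 : Tendsto (fun h : ℝ => t + h) (𝓝[>] 0) (𝓝[>] t) := by
    refine tendsto_nhdsWithin_iff.2 ⟨?_, ?_⟩
    · have : Continuous (fun h : ℝ => t + h) := by fun_prop
      simpa using (this.tendsto 0).mono_left (nhdsWithin_le_nhds (s := Ioi 0))
    · filter_upwards [self_mem_nhdsWithin] with x (hx : 0 < x)
      simp only [mem_Ioi]; linarith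
  refine (h.comp h2).congr ?_
  intro x
  simp [slope_def_module]

end generic

namespace GS

variable (M : GS X Y)

lemma delta_zero : M.δ 0 = 0 := by
  refine le_antisymm ?_ (M.δ_nonneg 0 le_rfl)
  refine ge_of_tendsto M.δ_lim ?_
  filter_upwards [self_mem_nhdsWithin] with t ht
  exact M.δ_mono ((mem_Ici.2 le_rfl)) (le_of_lt ht : (0:ℝ) ≤ t) (le_of_lt ht)

lemma SD_bound' {f : ℝ → X} (hf : ContinuousOn f (Ici 0)) {t C : ℝ} (ht : 0 ≤ t)
    (hC : ∀ s, 0 ≤ s → s ≤ t → ‖f s‖ ≤ C) : ‖M.SD f t‖ ≤ M.δ t * C := by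
  refine (M.SD_bound f hf t ht).trans ?_
  refine mul_le_mul_of_nonneg_left ?_ (M.δ_nonneg t ht)
  have : Nonempty (Icc (0:ℝ) t) := ⟨⟨0, le_rfl, ht⟩⟩
  exact ciSup_le (fun s => hC s s.2.1 s.2.2)

lemma SD_zero {f : ℝ → X} (hf : ContinuousOn f (Ici 0)) : M.SD f 0 = 0 := by
  have := M.SD_bound f hf 0 (mem_Ici.2 le_rfl)
  rw [M.delta_zero, zero_mul] at this
  simpa using this

lemma int_cont {f : ℝ → X} (hf : ContinuousOn f (Ici 0)) {t h : ℝ} (hh : 0 ≤ h) :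
    ContinuousOn (fun σ => M.S (t - σ + h) (f σ)) (Icc 0 t) := by
  refine jointCont_comp M.S M.S_cont (by fun_prop) ?_ (hf.mono Icc_subset_Ici_self)
  intro x hx
  have := hx.2
  linarith

lemma shift_cont {E : Type*} [TopologicalSpace E] {f : ℝ → E} (hf : ContinuousOn f (Ici 0)) {s : ℝ}
    (hs : 0 ≤ s) : ContinuousOn (fun σ => f (s + σ)) (Ici 0) :=
  hf.comp (by fun_prop) (fun x (hx : 0 ≤ x) => (by simp only [mem_Ici]; linarith : s + x ∈ Ici (0:ℝ)))

lemma SD_add {f g : ℝ → X} (hf : ContinuousOn f (Ici 0)) (hg : ContinuousOn g (Ici 0)) {t : ℝ}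
    (ht : 0 ≤ t) : M.SD (fun s => f s + g s) t = M.SD f t + M.SD g t := by
  have h1 := M.SD_deriv f hf t ht
  have h2 := M.SD_deriv g hg t ht
  have h3 := M.SD_deriv _ (hf.add hg) t ht
  refine (uniqueDiffOn_Ici (0:ℝ) t ht).eq_deriv _ h3 ((h1.add h2).congr ?_ ?_) <;>
  · intros
    simp only [map_add, Pi.add_apply]
    have key : ∀ τ : ℝ, 0 ≤ τ → ∫ s in (0:ℝ)..τ, (M.S (τ - s) (f s) + M.S (τ - s) (g s)) =
        (∫ s in (0:ℝ)..τ, M.S (τ - s) (f s)) + ∫ s in (0:ℝ)..τ, M.S (τ - s) (g s) := by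
      intro τ hτ
      apply intervalIntegral.integral_add
      · simpa using ((M.int_cont hf (t := τ) le_rfl).intervalIntegrable_of_Icc hτ)
      · simpa using ((M.int_cont hg (t := τ) le_rfl).intervalIntegrable_of_Icc hτ)
    exact key _ (by assumption)

lemma SD_limit {f : ℝ → X} (hf : ContinuousOn f (Ici 0)) {t : ℝ} (ht : 0 ≤ t) :
    Tendsto (fun h : ℝ => h⁻¹ • ∫ σ in (0:ℝ)..t, (M.S (t - σ + h) (f σ) - M.S (t - σ) (f σ)))
      (𝓝[>] 0) (𝓝 (M.SD f t)) := by
  have h1 : Tendsto (fun h : ℝ => h⁻¹ • ((∫ s in (0:ℝ)..(t + h), M.S (t + h - s) (f s)) -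
      ∫ s in (0:ℝ)..t, M.S (t - s) (f s))) (𝓝[>] 0) (𝓝 (M.SD f t)) := by
    have := ((M.SD_deriv f hf t ht).mono (Ici_subset_Ici.2 ht)).mono Ioi_subset_Ici_self
    exact slope_right this
  have hft := shift_cont hf ht
  have h2 : Tendsto (fun h : ℝ => h⁻¹ • ∫ s in (0:ℝ)..h, M.S (h - s) (f (t + s)))
      (𝓝[>] 0) (𝓝 0) := by
    have := (M.SD_deriv _ hft 0 (mem_Ici.2 le_rfl)).mono Ioi_subset_Ici_self
    rw [M.SD_zero hft] at this
    have := slope_right this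
    simpa using this
  have h3 := h1.sub h2
  rw [sub_zero] at h3
  refine h3.congr' ?_
  filter_upwards [self_mem_nhdsWithin] with h (hh : 0 < h)
  rw [← smul_sub]
  congr 1
  have c1 : ContinuousOn (fun s => M.S (t + h - s) (f s)) (Icc 0 (t + h)) := by
    simpa using M.int_cont hf (t := t + h) le_rfl
  have i1 : IntervalIntegrable (fun s => M.S (t + h - s) (f s)) volume 0 t :=
    (c1.mono (Icc_subset_Icc_right (by linarith))).intervalIntegrable_of_Icc ht
  have i2 : IntervalIntegrable (fun s => M.S (t + h - s) (f s)) volume t (t + h) :=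
    (c1.mono (Icc_subset_Icc_left (by linarith))).intervalIntegrable_of_Icc (by linarith)
  have i3 : IntervalIntegrable (fun s => M.S (t - s) (f s)) volume 0 t := by
    simpa using (M.int_cont hf (t := t) le_rfl).intervalIntegrable_of_Icc ht
  have e1 : (fun σ => M.S (t - σ + h) (f σ)) = fun σ => M.S (t + h - σ) (f σ) := by
    funext σ; congr 2; ring
  rw [intervalIntegral.integral_sub (by rw [e1]; exact i1) i3, e1,
    ← intervalIntegral.integral_add_adjacent_intervals i1 i2]
  have e2 : ∫ s in t..(t + h), M.S (t + h - s) (f s) = ∫ s in (0:ℝ)..h, M.S (h - s) (f (t + s)) := by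
    have := intervalIntegral.integral_comp_add_left (a := 0) (b := h)
      (fun s => M.S (t + h - s) (f s)) t
    rw [add_zero] at this
    rw [← this]
    congr 1; funext s; congr 2; ring
  rw [e2]; abel

lemma SD_cocycle {f : ℝ → X} (hf : ContinuousOn f (Ici 0)) {t s : ℝ} (ht : 0 ≤ t) (hs : 0 ≤ s) :
    M.SD f (t + s) = M.T t (M.SD f s) + M.SD (fun σ => f (s + σ)) t := by
  have h1 := M.SD_limit hf (add_nonneg ht hs)
  have h2 := M.SD_limit hf hs
  have h3 := M.SD_limit (shift_cont hf hs) ht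
  have h4 := (((M.T t).continuous.tendsto _).comp h2).add h3
  refine tendsto_nhds_unique h1 (h4.congr' ?_)
  filter_upwards [self_mem_nhdsWithin] with h (hh : 0 < h)
  simp only [Function.comp]
  rw [(M.T t).map_smul_of_tower, ← smul_add]
  congr 1
  have c1 : ContinuousOn (fun σ => M.S (t + s - σ + h) (f σ) - M.S (t + s - σ) (f σ))
      (Icc 0 (t + s)) := by
    have := (M.int_cont hf (t := t + s) hh.le).sub (M.int_cont hf (t := t + s) le_rfl)
    simp only [add_zero] at this
    exact this
  have c2 : ContinuousOn (fun σ => M.S (s - σ + h) (f σ) - M.S (s - σ) (f σ))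
      (Icc 0 s) := by
    have := (M.int_cont hf (t := s) hh.le).sub (M.int_cont hf (t := s) le_rfl)
    simp only [add_zero] at this
    exact this
  have i1 := (c1.mono (Icc_subset_Icc_right (by linarith : s ≤ t + s))).intervalIntegrable_of_Icc
    (μ := volume) hs
  have i2 := (c1.mono (Icc_subset_Icc_left hs)).intervalIntegrable_of_Icc
    (μ := volume) (by linarith : s ≤ t + s)
  rw [← intervalIntegral.integral_add_adjacent_intervals i1 i2,
    ← (M.T t).intervalIntegral_comp_comm (c2.intervalIntegrable_of_Icc hs)]
  congr 1
  · apply intervalIntegral.integral_congr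
    intro σ hσ
    rw [uIcc_of_le hs] at hσ
    have hσ' : 0 ≤ s - σ := by linarith [hσ.2]
    simp only [map_sub]
    rw [M.TS t (s - σ + h) ht (by linarith), M.TS t (s - σ) ht hσ']
    rw [show t + (s - σ + h) = t + s - σ + h by ring, show t + (s - σ) = t + s - σ by ring]
    abel
  · have := intervalIntegral.integral_comp_add_left (a := 0) (b := t)
      (fun σ => M.S (t + s - σ + h) (f σ) - M.S (t + s - σ) (f σ)) s
    rw [add_zero, add_comm s t] at this
    rw [← this]
    congr 1; funext σ
    rw [show t + s - (s + σ) = t - σ by ring]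

end GS

/-- Strong continuity on `[0,∞)`. -/
def SC (U : ℝ → (Y →L[ℂ] Y)) : Prop := ∀ x : Y, ContinuousOn (fun t => U t x) (Ici 0)

namespace GS

variable (M : GS X Y) (L : Y →L[ℂ] X)

lemma SC_L {U : ℝ → (Y →L[ℂ] Y)} (hU : SC U) (x : Y) :
    ContinuousOn (fun s => L (U s x)) (Ici 0) :=
  L.continuous.comp_continuousOn (hU x)

lemma SC_add {U V : ℝ → (Y →L[ℂ] Y)} (hU : SC U) (hV : SC V) : SC (fun t => U t + V t) :=
  fun x => (hU x).add (hV x)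

lemma SC_sub {U V : ℝ → (Y →L[ℂ] Y)} (hU : SC U) (hV : SC V) : SC (fun t => U t - V t) :=
  fun x => (hU x).sub (hV x)

lemma SC_shift {U : ℝ → (Y →L[ℂ] Y)} (hU : SC U) {s : ℝ} (hs : 0 ≤ s) :
    SC (fun t => U (s + t)) :=
  fun x => shift_cont (hU x) hs

lemma SC_mul {U : ℝ → (Y →L[ℂ] Y)} (hU : SC U) (K : Y →L[ℂ] Y) : SC (fun t => U t * K) :=
  fun x => hU (K x)

lemma SC_zero : SC (fun _ => (0 : Y →L[ℂ] Y)) := fun _ => continuousOn_const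

lemma SC_sum {ι : Type*} (s : Finset ι) {U : ι → ℝ → (Y →L[ℂ] Y)} (hU : ∀ i ∈ s, SC (U i)) :
    SC (fun t => ∑ i ∈ s, U i t) := by
  intro x
  simp only [sum_apply]
  exact continuousOn_finsetSum _ (fun i hi => hU i hi x)

lemma SC_congr {U V : ℝ → (Y →L[ℂ] Y)} (hU : SC U) (h : ∀ t, 0 ≤ t → U t = V t) : SC V :=
  fun x => (hU x).congr (fun t ht => by simp [h t ht])

lemma SC_T : SC M.T := M.T_cont

lemma B_apply {U : ℝ → (Y →L[ℂ] Y)} (hU : SC U) (t : ℝ) (x : Y) :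
    M.Bop L U t x = M.SD (fun s => L (U s x)) t := by
  rw [Bop, M.SDop_apply _ (SC_L L hU)]; rfl

lemma SC_B {U : ℝ → (Y →L[ℂ] Y)} (hU : SC U) : SC (M.Bop L U) := by
  intro x
  simp only [M.B_apply L hU]
  exact M.SD_cont _ (SC_L L hU x)

lemma B_norm {U : ℝ → (Y →L[ℂ] Y)} (hU : SC U) {t C : ℝ} (ht : 0 ≤ t) (hC0 : 0 ≤ C)
    (hC : ∀ s, 0 ≤ s → s ≤ t → ‖U s‖ ≤ C) : ‖M.Bop L U t‖ ≤ M.δ t * (‖L‖ * C) := by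
  refine ContinuousLinearMap.opNorm_le_bound _
    (mul_nonneg (M.δ_nonneg t ht) (mul_nonneg (norm_nonneg _) hC0)) ?_
  intro x
  rw [M.B_apply L hU]
  rw [mul_assoc]
  refine M.SD_bound' (SC_L L hU x) ht ?_
  intro s h0 h1
  rw [mul_assoc]
  exact L.le_opNorm_of_le ((U s).le_of_opNorm_le (hC s h0 h1) x)

lemma B_zero {U : ℝ → (Y →L[ℂ] Y)} (hU : SC U) : M.Bop L U 0 = 0 := by
  ext1 x
  rw [M.B_apply L hU, M.SD_zero (SC_L L hU x)]; rfl

lemma B_add {U V : ℝ → (Y →L[ℂ] Y)} (hU : SC U) (hV : SC V) {t : ℝ} (ht : 0 ≤ t) :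
    M.Bop L (fun s => U s + V s) t = M.Bop L U t + M.Bop L V t := by
  ext1 x
  rw [add_apply, M.B_apply L (SC_add hU hV), M.B_apply L hU, M.B_apply L hV,
    ← M.SD_add (SC_L L hU x) (SC_L L hV x) ht]
  simp

lemma B_sub {U V : ℝ → (Y →L[ℂ] Y)} (hU : SC U) (hV : SC V) {t : ℝ} (ht : 0 ≤ t) :
    M.Bop L (fun s => U s - V s) t = M.Bop L U t - M.Bop L V t := by
  rw [eq_sub_iff_add_eq, ← M.B_add L (SC_sub hU hV) hV ht]
  simp

lemma B_congr {U V : ℝ → (Y →L[ℂ] Y)} (hU : SC U) (h : ∀ s, 0 ≤ s → U s = V s)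
    {t : ℝ} (ht : 0 ≤ t) : M.Bop L U t = M.Bop L V t := by
  have hV := SC_congr hU h
  rw [← sub_eq_zero, ← M.B_sub L hU hV ht, ← norm_le_zero_iff]
  have := M.B_norm L (SC_sub hU hV) ht le_rfl (fun s h0 _ => by simp [h s h0])
  simpa using this

lemma B_sum {ι : Type*} (s : Finset ι) {U : ι → ℝ → (Y →L[ℂ] Y)} (hU : ∀ i ∈ s, SC (U i))
    {t : ℝ} (ht : 0 ≤ t) :
    M.Bop L (fun τ => ∑ i ∈ s, U i τ) t = ∑ i ∈ s, M.Bop L (U i) t := by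
  classical
  induction s using Finset.induction_on with
  | empty =>
    have := M.B_norm L (SC_zero (Y := Y)) ht le_rfl (by simp)
    simpa using this
  | insert a s ha ih =>
    simp only [Finset.sum_insert ha]
    rw [M.B_add L (hU a (by simp)) (SC_sum s (fun i hi => hU i (by simp [hi]))) ht,
      ih (fun i hi => hU i (by simp [hi]))]

lemma B_mul {U : ℝ → (Y →L[ℂ] Y)} (hU : SC U) (K : Y →L[ℂ] Y) (t : ℝ) :
    M.Bop L (fun s => U s * K) t = M.Bop L U t * K := by
  ext1 x
  rw [M.B_apply L (SC_mul hU K), mul_apply_eq_comp, M.B_apply L hU]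
  rfl

lemma B_cocycle {U : ℝ → (Y →L[ℂ] Y)} (hU : SC U) {t s : ℝ} (ht : 0 ≤ t) (hs : 0 ≤ s) :
    M.Bop L U (t + s) = M.T t * M.Bop L U s + M.Bop L (fun σ => U (s + σ)) t := by
  ext1 x
  rw [add_apply, mul_apply_eq_comp,
    M.B_apply L hU, M.B_apply L hU, M.B_apply L (SC_shift hU hs),
    M.SD_cocycle (SC_L L hU x) ht hs]

lemma bdd (M : GS X Y) {U : ℝ → (Y →L[ℂ] Y)} (hU : SC U) (b : ℝ) :
    ∃ C, 0 ≤ C ∧ ∀ t, 0 ≤ t → t ≤ b → ‖U t‖ ≤ C := by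
  exact locBdd U hU b

lemma SC_iter {U : ℝ → (Y →L[ℂ] Y)} (hU : SC U) (n : ℕ) : SC ((M.Bop L)^[n] U) := by
  induction n with
  | zero => exact hU
  | succ n ih => rw [Function.iterate_succ_apply']; exact M.SC_B L ih

lemma delta_small {η : ℝ} (hη : 0 < η) : ∃ τ > 0, M.δ τ ≤ η ∧ ∀ s, 0 ≤ s → s ≤ τ → M.δ s ≤ η := by
  have h := M.δ_lim.eventually (gt_mem_nhds hη)
  obtain ⟨τ, hτ, hτ2⟩ := (h.and self_mem_nhdsWithin).exists
  exact ⟨τ, hτ2, hτ.le, fun s h0 h1 =>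
    (M.δ_mono h0 (le_of_lt hτ2 : (0:ℝ) ≤ τ) h1).trans hτ.le⟩

/-- geometric decay of the iterates `Bᵏ U` on bounded intervals. -/
lemma iter_decay {U : ℝ → (Y →L[ℂ] Y)} (hU : SC U) (t : ℝ) (ht : 0 ≤ t) :
    Tendsto (fun k => (M.Bop L)^[k] U t) atTop (𝓝 0) := by
  obtain ⟨τ, hτ, hδ, hδ'⟩ := M.delta_small (η := 1 / (2 * (‖L‖ + 1))) (by positivity)
  have hL : ∀ s, 0 ≤ s → s ≤ τ → M.δ s * ‖L‖ ≤ 1 / 2 := by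
    intro s h0 h1
    calc M.δ s * ‖L‖ ≤ 1 / (2 * (‖L‖ + 1)) * ‖L‖ := by gcongr; exact hδ' s h0 h1
      _ ≤ 1 / (2 * (‖L‖ + 1)) * (‖L‖ + 1) := by gcongr; linarith
      _ = 1 / 2 := by field_simp
  obtain ⟨CT, hCT0, hCT⟩ := M.bdd M.SC_T τ
  have key : ∀ m : ℕ, ∃ A, 0 ≤ A ∧ ∀ k : ℕ, ∀ s, 0 ≤ s → s ≤ m * τ →
      ‖(M.Bop L)^[k] U s‖ ≤ A * (3/4)^k := by
    intro m
    induction m with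
    | zero =>
      refine ⟨‖U 0‖, norm_nonneg _, ?_⟩
      intro k s h0 h1
      have : s = 0 := by simp at h1; linarith
      subst this
      cases k with
      | zero => simp
      | succ k =>
        rw [Function.iterate_succ_apply', M.B_zero L (M.SC_iter L hU k)]
        simp; positivity
    | succ m ih =>
      obtain ⟨A, hA0, hA⟩ := ih
      obtain ⟨C, hC0, hC⟩ := M.bdd hU ((m + 1) * τ)
      refine ⟨max C (max A (3 * CT * A)), by positivity, ?_⟩
      set A' := max C (max A (3 * CT * A))
      have hA'0 : 0 ≤ A' := by positivity
      have hA1 : A ≤ A' := (le_max_left _ _).trans (le_max_right _ _)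
      have hA2 : 3 * CT * A ≤ A' := (le_max_right _ _).trans (le_max_right _ _)
      intro k
      induction k with
      | zero =>
        intro s h0 h1
        push_cast at h1
        rw [pow_zero, mul_one]
        exact (hC s h0 h1).trans (le_max_left _ _)
      | succ k ihk =>
        intro s h0 h1
        push_cast at h1
        by_cases hs : s ≤ m * τ
        · refine (hA (k+1) s h0 hs).trans ?_
          gcongr
        · push Not at hs
          have hm : 0 ≤ (m:ℝ) * τ := by positivity
          have e : s = (s - m * τ) + m * τ := by ring
          have hst : s - m * τ ≤ τ := by linarith
          have hsc := M.SC_iter L hU k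
          have b1 := hA (k+1) (m * τ) hm le_rfl
          rw [Function.iterate_succ_apply'] at b1 ⊢
          rw [e, M.B_cocycle L hsc (by linarith) hm]
          have b2 := M.B_norm L (SC_shift hsc hm) (t := s - m * τ) (by linarith)
            (C := A' * (3/4)^k) (by positivity) (by
              intro σ hσ0 hσ1
              exact ihk _ (by linarith) (by push_cast; linarith))
          have b3 := hL (s - m * τ) (by linarith) hst
          calc _ ≤ ‖M.T (s - m * τ)‖ * ‖M.Bop L ((M.Bop L)^[k] U) (m * τ)‖ + _ :=
                (norm_add_le _ _).trans (add_le_add_left (norm_mul_le _ _) _)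
            _ ≤ CT * (A * (3/4)^(k+1)) + (1/2) * (A' * (3/4)^k) := by
                refine add_le_add (mul_le_mul (hCT _ (by linarith) hst) b1 (norm_nonneg _) hCT0)
                  (b2.trans ?_)
                rw [← mul_assoc]
                gcongr
            _ = (3 * CT * A) / 3 * (3/4)^(k+1) + (2/3) * (A' * (3/4)^(k+1)) := by
                rw [pow_succ]; ring
            _ ≤ A' / 3 * (3/4)^(k+1) + (2/3) * (A' * (3/4)^(k+1)) := by gcongr
            _ = _ := by ring
  obtain ⟨m, hm⟩ := exists_nat_ge (t / τ)
  obtain ⟨A, hA0, hA⟩ := key m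
  rw [div_le_iff₀ hτ] at hm
  refine squeeze_zero_norm (fun k => hA k t ht hm) ?_
  simpa using (tendsto_pow_atTop_nhds_zero_of_lt_one (by norm_num : (0:ℝ) ≤ 3/4)
    (by norm_num)).const_mul A

/-- Dyson-Phillips convolution identity. -/
lemma conv (k : ℕ) : ∀ t s : ℝ, 0 ≤ t → 0 ≤ s → (M.Bop L)^[k] M.T (t + s) =
    ∑ p ∈ Finset.HasAntidiagonal.antidiagonal k, (M.Bop L)^[p.1] M.T t * (M.Bop L)^[p.2] M.T s := by
  induction k with
  | zero => intro t s ht hs; simpa [ContinuousLinearMap.mul_def] using M.T_add t s ht hs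
  | succ k ih =>
    intro t s ht hs
    have hsc := M.SC_iter L M.SC_T
    rw [Function.iterate_succ_apply', M.B_cocycle L (hsc k) ht hs,
      Finset.Nat.antidiagonal_succ, Finset.sum_cons, Function.iterate_zero, id_eq,
      Function.iterate_succ_apply', Finset.sum_map]
    congr 1
    have e : ∀ σ, 0 ≤ σ → ∑ p ∈ Finset.HasAntidiagonal.antidiagonal k,
        (M.Bop L)^[p.1] M.T σ * (M.Bop L)^[p.2] M.T s = (M.Bop L)^[k] M.T (s + σ) := by
      intro σ hσ
      rw [add_comm, ih σ s hσ hs]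
    rw [← M.B_congr L (SC_sum _ (fun p _ => SC_mul (hsc p.1) _)) e ht,
      M.B_sum L _ (fun p _ => SC_mul (hsc p.1) _) ht]
    refine Finset.sum_congr rfl (fun p _ => ?_)
    rw [M.B_mul L (hsc p.1)]
    simp [Function.iterate_succ_apply']

/-- expansion of `R`: `Rₘ = ∑_{m ≤ k < m+n} Sₖ + R_{m+n}`. -/
lemma iter_R_succ {R : ℝ → (Y →L[ℂ] Y)} (hR : SC R)
    (hfix : ∀ t ∈ Ici (0:ℝ), R t = M.T t + M.Bop L R t) (m : ℕ) : ∀ t, 0 ≤ t →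
    (M.Bop L)^[m] R t = (M.Bop L)^[m] M.T t + (M.Bop L)^[m+1] R t := by
  induction m with
  | zero => intro t ht; exact hfix t ht
  | succ m ih =>
    intro t ht
    rw [Function.iterate_succ_apply', M.B_congr L (M.SC_iter L hR m) ih ht,
      M.B_add L (M.SC_iter L M.SC_T m) (M.SC_iter L hR (m+1)) ht, ← Function.iterate_succ_apply' (M.Bop L) m,
      ← Function.iterate_succ_apply' (M.Bop L) (m+1)]

lemma iter_R_sum {R : ℝ → (Y →L[ℂ] Y)} (hR : SC R)
    (hfix : ∀ t ∈ Ici (0:ℝ), R t = M.T t + M.Bop L R t) (m n : ℕ) (t : ℝ) (ht : 0 ≤ t) :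
    (M.Bop L)^[m] R t = ∑ k ∈ Finset.range n, (M.Bop L)^[m + k] M.T t + (M.Bop L)^[m+n] R t := by
  induction n with
  | zero => simp
  | succ n ih =>
    rw [ih, Finset.sum_range_succ, M.iter_R_succ L hR hfix (m+n) t ht]
    rw [← add_assoc]; rfl

end GS

namespace GS

variable (M : GS X Y) (L : Y →L[ℂ] X)

/-- `U` is almost an orbit of `T`. -/
def AO (U : ℝ → (Y →L[ℂ] Y)) : Prop :=
  ∀ b : ℝ, ∃ C, 0 ≤ C ∧ ∀ t h : ℝ, 0 ≤ t → 0 ≤ h → t + h ≤ b →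
    ‖U (t + h) - M.T h * U t‖ ≤ C * M.δ h

lemma AO_T : M.AO M.T := by
  intro b
  refine ⟨0, le_rfl, fun t h ht hh _ => ?_⟩
  rw [add_comm, M.T_add h t hh ht, ContinuousLinearMap.mul_def]
  simp

lemma AO_B {U : ℝ → (Y →L[ℂ] Y)} (hU : SC U) : M.AO (M.Bop L U) := by
  intro b
  obtain ⟨C, hC0, hC⟩ := M.bdd hU b
  refine ⟨‖L‖ * C, by positivity, fun t h ht hh hb => ?_⟩
  rw [add_comm, M.B_cocycle L hU hh ht, add_sub_cancel_left, mul_comm (‖L‖ * C)]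
  exact M.B_norm L (SC_shift hU ht) hh hC0 (fun s h0 h1 => hC _ (by linarith) (by linarith))

lemma AO_R {R : ℝ → (Y →L[ℂ] Y)} (hR : SC R)
    (hfix : ∀ t ∈ Ici (0:ℝ), R t = M.T t + M.Bop L R t) : M.AO R := by
  intro b
  obtain ⟨C1, h10, h1⟩ := M.AO_T b
  obtain ⟨C2, h20, h2⟩ := M.AO_B L hR b
  refine ⟨C1 + C2, by positivity, fun t h ht hh hb => ?_⟩
  rw [hfix t ht, hfix (t + h) (add_nonneg ht hh), mul_add, add_mul, add_sub_add_comm]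
  exact (norm_add_le _ _).trans (add_le_add (h1 t h ht hh hb) (h2 t h ht hh hb))

lemma AO_iter {U : ℝ → (Y →L[ℂ] Y)} (hU : SC U) (h : M.AO U) (n : ℕ) :
    M.AO ((M.Bop L)^[n] U) := by
  cases n with
  | zero => exact h
  | succ n => rw [Function.iterate_succ_apply']; exact M.AO_B L (M.SC_iter L hU n)

lemma cont_TK {K : Y →L[ℂ] Y} (hK : IsCompactOperator K) :
    ContinuousOn (fun s => M.T s * K) (Ici 0) := by
  obtain ⟨Q, hQ, hKQ⟩ := hK.image_closedBall_subset_compact (f := (K : Y →ₗ[ℂ] Y)) 1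
  intro s0 hs0
  rw [ContinuousWithinAt, Metric.tendsto_nhds]
  intro η hη
  have hj : ContinuousOn (Function.uncurry fun (s : ℝ) (y : Y) => M.T s y) (Ici 0 ×ˢ Q) :=
    (jointCont M.T M.T_cont).mono (prod_mono le_rfl (subset_univ _))
  have := hQ.mem_uniformity_of_prod hj hs0 (Metric.dist_mem_uniformity (half_pos hη))
  obtain ⟨v, hv, hv2⟩ := this
  filter_upwards [hv] with s hs
  refine lt_of_le_of_lt ?_ (half_lt_self hη)
  rw [dist_eq_norm]
  refine ContinuousLinearMap.opNorm_le_of_unit_norm (𝕜 := ℂ) (half_pos hη).le ?_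
  intro x hx
  have hx2 := hv2 s hs (K x) (hKQ ⟨x, by simp [hx], rfl⟩)
  rw [← sub_mul]
  have : dist (M.T s (K x)) (M.T s0 (K x)) < η / 2 := hx2
  rw [dist_eq_norm] at this
  simpa using this.le

lemma cont_of_compact {U : ℝ → (Y →L[ℂ] Y)} (hA : M.AO U)
    (hK : ∀ t, 0 < t → IsCompactOperator (U t)) : ContinuousOn U (Ioi 0) := by
  intro t0 (ht0 : 0 < t0)
  refine ContinuousAt.continuousWithinAt ?_
  refine continuousAt_of_locally_uniform_approx_of_continuousAt ?_
  intro u hu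
  obtain ⟨η, hη, hu⟩ := Metric.mem_uniformity_dist.1 hu
  obtain ⟨C, hC0, hC⟩ := hA (2 * t0)
  obtain ⟨τ, hτ, -, hτ2⟩ := M.delta_small (η := η / (2 * (C + 1))) (by positivity)
  set ε := min (τ / 2) (t0 / 2)
  have hε : 0 < ε := by positivity
  have hε1 : ε ≤ τ / 2 := min_le_left _ _
  have hε2 : ε ≤ t0 / 2 := min_le_right _ _
  refine ⟨Metric.ball t0 ε, Metric.ball_mem_nhds _ hε,
    fun t => M.T (t - (t0 - ε)) * U (t0 - ε), ?_, ?_⟩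
  · have h1 := M.cont_TK (hK (t0 - ε) (by linarith))
    have h2 : ContinuousAt (fun s => M.T s * U (t0 - ε)) (t0 - (t0 - ε)) :=
      h1.continuousAt (Ici_mem_nhds (by linarith))
    exact ContinuousAt.comp (f := fun t => t - (t0 - ε)) h2 (by fun_prop)
  · intro t ht
    apply hu
    rw [Metric.mem_ball, Real.dist_eq, abs_lt] at ht
    rw [dist_eq_norm]
    have := hC (t0 - ε) (t - (t0 - ε)) (by linarith) (by linarith) (by linarith)
    rw [add_sub_cancel] at this
    refine this.trans_lt ?_
    calc C * M.δ (t - (t0 - ε)) ≤ C * (η / (2 * (C + 1))) := by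
          gcongr; exact hτ2 _ (by linarith) (by linarith)
      _ ≤ (C + 1) * (η / (2 * (C + 1))) := by gcongr; linarith
      _ = η / 2 := by field_simp
      _ < η := half_lt_self hη

lemma B_cont_Ici {V : ℝ → (Y →L[ℂ] Y)} (hV : SC V) (hc : ContinuousOn V (Ici 0)) :
    ContinuousOn (M.Bop L V) (Ici 0) := by
  intro t0 (ht0 : 0 ≤ t0)
  set b := t0 + 1 with hb
  obtain ⟨C, hC0, hC⟩ := M.bdd hV b
  obtain ⟨CT, hCT0, hCT⟩ := M.bdd M.SC_T b
  have huc := isCompact_Icc.uniformContinuousOn_of_continuous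
    (hc.mono (Icc_subset_Ici_self : Icc 0 (2 * b) ⊆ Ici 0))
  rw [Metric.uniformContinuousOn_iff] at huc
  rw [Metric.continuousWithinAt_iff]
  intro η hη
  have hδb := M.δ_nonneg b (by linarith)
  obtain ⟨d1, hd1, hd1'⟩ := huc (η / (4 * (M.δ b * ‖L‖ + 1))) (by positivity)
  obtain ⟨τ, hτ, -, hτ2⟩ := M.delta_small (η := η / (4 * (CT * (‖L‖ * C) + 1))) (by positivity)
  have key : ∀ s h, 0 ≤ s → 0 ≤ h → h ≤ 1 → s + h ≤ b → h < d1 → h ≤ τ →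
      ‖M.Bop L V (s + h) - M.Bop L V s‖ < η := by
    intro s h hs hh hh1 hsb hhd hhτ
    rw [M.B_cocycle L hV hs hh, add_sub_assoc, ← M.B_sub L (SC_shift hV hh) hV hs]
    have e1 : ‖M.T s * M.Bop L V h‖ ≤ η / 4 := by
      refine (norm_mul_le _ _).trans ?_
      have q1 := hCT s hs (by linarith)
      have q2 := M.B_norm L hV hh hC0 (fun s h0 h1 => hC s h0 (by linarith))
      calc ‖M.T s‖ * ‖M.Bop L V h‖ ≤ CT * (M.δ h * (‖L‖ * C)) :=
            mul_le_mul q1 q2 (norm_nonneg _) hCT0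
        _ ≤ CT * (η / (4 * (CT * (‖L‖ * C) + 1)) * (‖L‖ * C)) := by
            gcongr; exact hτ2 h hh hhτ
        _ = (CT * (‖L‖ * C)) * (η / (4 * (CT * (‖L‖ * C) + 1))) := by ring
        _ ≤ (CT * (‖L‖ * C) + 1) * (η / (4 * (CT * (‖L‖ * C) + 1))) := by gcongr; linarith
        _ = η / 4 := by field_simp
    have e2 : ‖M.Bop L (fun σ => V (h + σ) - V σ) s‖ ≤ η / 4 := by
      have q := M.B_norm L (SC_sub (SC_shift hV hh) hV) hs
        (C := η / (4 * (M.δ b * ‖L‖ + 1))) (by positivity) (by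
          intro σ h0 h1
          have := hd1' (h + σ) ⟨by linarith, by linarith⟩ σ ⟨by linarith, by linarith⟩
            (by rw [Real.dist_eq, add_sub_cancel_right, abs_of_nonneg hh]; exact hhd)
          rw [dist_eq_norm] at this
          exact this.le)
      refine q.trans ?_
      calc M.δ s * (‖L‖ * (η / (4 * (M.δ b * ‖L‖ + 1))))
          ≤ M.δ b * (‖L‖ * (η / (4 * (M.δ b * ‖L‖ + 1)))) := by
            gcongr
            exact M.δ_mono hs (by simp only [mem_Ici]; linarith) (by linarith)
        _ = (M.δ b * ‖L‖) * (η / (4 * (M.δ b * ‖L‖ + 1))) := by ring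
        _ ≤ (M.δ b * ‖L‖ + 1) * (η / (4 * (M.δ b * ‖L‖ + 1))) := by gcongr; linarith
        _ = η / 4 := by field_simp
    refine (norm_add_le _ _).trans_lt ?_
    linarith
  refine ⟨min (min d1 τ) 1, by positivity, ?_⟩
  intro t (ht : 0 ≤ t) htd
  rw [Real.dist_eq, lt_min_iff, lt_min_iff] at htd
  obtain ⟨⟨h1, h2⟩, h3⟩ := htd
  rw [dist_eq_norm]
  rcases le_total t0 t with hle | hle
  · rw [abs_of_nonneg (by linarith)] at h1 h2 h3
    have := key t0 (t - t0) ht0 (by linarith) (by linarith) (by linarith) h1 h2.le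
    rwa [add_sub_cancel] at this
  · rw [abs_of_nonpos (by linarith), neg_sub] at h1 h2 h3
    have := key t (t0 - t) ht (by linarith) (by linarith) (by linarith) h1 h2.le
    rw [add_sub_cancel] at this
    rwa [norm_sub_rev]

/-- uniform approximation of `B U` by `B` of shifts. -/
lemma B_shift_approx {U : ℝ → (Y →L[ℂ] Y)} (hU : SC U) (b : ℝ) {η : ℝ} (hη : 0 < η) :
    ∃ τ > 0, ∀ ε, 0 ≤ ε → ε ≤ τ → ∀ t, ε ≤ t → t ≤ b →
      ‖M.Bop L U t - M.Bop L (fun σ => U (ε + σ)) (t - ε)‖ < η := by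
  obtain ⟨C, hC0, hC⟩ := M.bdd hU b
  obtain ⟨CT, hCT0, hCT⟩ := M.bdd M.SC_T b
  obtain ⟨τ, hτ, -, hτ2⟩ := M.delta_small (η := η / (2 * (CT * (‖L‖ * C) + 1))) (by positivity)
  refine ⟨τ, hτ, ?_⟩
  intro ε h0 h1 t h2 h3
  have e := M.B_cocycle L hU (t := t - ε) (s := ε) (by linarith) h0
  rw [sub_add_cancel] at e
  rw [e, add_sub_cancel_right]
  refine (norm_mul_le _ _).trans_lt ?_
  have q1 := hCT (t - ε) (by linarith) (by linarith)
  have q2 := M.B_norm L hU h0 hC0 (fun s h0 h1 => hC s h0 (by linarith))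
  calc ‖M.T (t - ε)‖ * ‖M.Bop L U ε‖ ≤ CT * (M.δ ε * (‖L‖ * C)) :=
        mul_le_mul q1 q2 (norm_nonneg _) hCT0
    _ ≤ CT * (η / (2 * (CT * (‖L‖ * C) + 1)) * (‖L‖ * C)) := by
        gcongr; exact hτ2 ε h0 h1
    _ = (CT * (‖L‖ * C)) * (η / (2 * (CT * (‖L‖ * C) + 1))) := by ring
    _ ≤ (CT * (‖L‖ * C) + 1) * (η / (2 * (CT * (‖L‖ * C) + 1))) := by gcongr; linarith
    _ = η / 2 := by field_simp
    _ < η := half_lt_self hη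

lemma shift_cont_Ioi {U : ℝ → (Y →L[ℂ] Y)} (hc : ContinuousOn U (Ioi 0)) {ε : ℝ} (hε : 0 < ε) :
    ContinuousOn (fun σ => U (ε + σ)) (Ici 0) :=
  hc.comp (by fun_prop) (fun x (hx : 0 ≤ x) => (by simp only [mem_Ioi]; linarith))

lemma B_cont {U : ℝ → (Y →L[ℂ] Y)} (hU : SC U) (hc : ContinuousOn U (Ioi 0)) :
    ContinuousOn (M.Bop L U) (Ioi 0) := by
  intro t0 (ht0 : 0 < t0)
  refine ContinuousAt.continuousWithinAt ?_
  refine continuousAt_of_locally_uniform_approx_of_continuousAt ?_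
  intro u hu
  obtain ⟨η, hη, hu⟩ := Metric.mem_uniformity_dist.1 hu
  obtain ⟨τ, hτ, hτ2⟩ := M.B_shift_approx L hU (2 * t0) hη
  set ε := min τ (t0 / 2)
  have hε : 0 < ε := by positivity
  have hε2 : ε ≤ t0 / 2 := min_le_right _ _
  refine ⟨Ioo ε (2 * t0), Ioo_mem_nhds (by linarith) (by linarith),
    fun t => M.Bop L (fun σ => U (ε + σ)) (t - ε), ?_, ?_⟩
  · have h1 := M.B_cont_Ici L (SC_shift hU hε.le) (shift_cont_Ioi hc hε)
    have h2 := h1.continuousAt (Ici_mem_nhds (by linarith : 0 < t0 - ε))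
    exact ContinuousAt.comp (f := fun t => t - ε) h2 (by fun_prop)
  · intro t ht
    apply hu
    rw [dist_eq_norm]
    exact hτ2 ε hε.le (min_le_left _ _) t ht.1.le ht.2.le

lemma isCompactOperator_sum {ι : Type*} (s : Finset ι) (K : ι → (Y →L[ℂ] Y))
    (h : ∀ i ∈ s, IsCompactOperator (K i)) : IsCompactOperator (∑ i ∈ s, K i : Y →L[ℂ] Y) := by
  classical
  induction s using Finset.induction_on with
  | empty => simpa using (isCompactOperator_zero : IsCompactOperator (0 : Y → Y))
  | insert a s ha ih =>
    rw [Finset.sum_insert ha]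
    exact (h a (by simp)).add (ih (fun i hi => h i (by simp [hi])))

lemma bernstein_bound {E : Type*} [NormedAddCommGroup E] [NormedSpace ℝ E]
    (g : unitInterval → E) (hg : Continuous g) :
    ∃ a : ℕ → ℝ, (∀ N, 0 ≤ a N) ∧ Tendsto a atTop (𝓝 0) ∧ ∀ N x,
      ‖(∑ k : Fin (N + 1), bernstein N k x • g (bernstein.z k)) - g x‖ ≤ a N := by
  let f : C(unitInterval, E) := ⟨g, hg⟩
  have hf := bernsteinApproximation_uniform f
  refine ⟨fun N => ‖bernsteinApproximation N f - f‖, fun _ => norm_nonneg _,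
    tendsto_iff_norm_sub_tendsto_zero.1 hf, fun N x => ?_⟩
  have := (bernsteinApproximation N f - f).norm_coe_le_norm x
  rwa [ContinuousMap.sub_apply, bernsteinApproximation.apply] at this

lemma B_compact_aux {V : ℝ → (Y →L[ℂ] Y)} (hV : SC V) (hc : ContinuousOn V (Ici 0))
    (hK : ∀ t, 0 ≤ t → IsCompactOperator (V t)) {r : ℝ} (hr : 0 < r) :
    IsCompactOperator (M.Bop L V r) := by
  let f : unitInterval → (Y →L[ℂ] Y) := fun x => V (r * x)
  have hfc : Continuous f := by
    rw [← continuousOn_univ]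
    refine hc.comp (by fun_prop) (fun x _ => ?_)
    exact mul_nonneg hr.le x.2.1
  obtain ⟨a, ha0, ha, hab⟩ := bernstein_bound f hfc
  let pr : ℝ → unitInterval := fun s => projIcc 0 1 zero_le_one (s / r)
  have hpr : Continuous pr := continuous_projIcc.comp (by fun_prop)
  let φ : (N : ℕ) → Fin (N + 1) → ℝ → (Y →L[ℂ] Y) := fun N k s => (bernstein N k (pr s)) • 1
  have hφ : ∀ N k, SC (φ N k) := by
    intro N k x
    have : Continuous fun t => (φ N k t) x := by
      simp only [φ, _root_.smul_apply]
      fun_prop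
    exact this.continuousOn
  let z : (N : ℕ) → Fin (N + 1) → unitInterval := fun N k => bernstein.z k
  let W : ℕ → ℝ → (Y →L[ℂ] Y) := fun N s => ∑ k : Fin (N + 1), φ N k s * f (z N k)
  have hW : ∀ N, SC (W N) := fun N => SC_sum _ (fun k _ => SC_mul (hφ N k) _)
  have hWf : ∀ N s, W N s = ∑ k : Fin (N + 1), bernstein N k (pr s) • f (bernstein.z k) := by
    intro N s
    refine Finset.sum_congr rfl (fun k _ => ?_)
    simp [φ, z]
  have hVf : ∀ s, 0 ≤ s → s ≤ r → V s = f (pr s) := by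
    intro s h0 h1
    have : (pr s : ℝ) = s / r := by
      simp only [pr]
      rw [projIcc_of_mem zero_le_one ⟨by positivity, (div_le_one hr).2 h1⟩]
    change V s = V (r * (pr s : ℝ))
    rw [this]; congr 1; field_simp
  have hlim : Tendsto (fun N => M.Bop L (W N) r) atTop (𝓝 (M.Bop L V r)) := by
    rw [tendsto_iff_norm_sub_tendsto_zero]
    have hf2 := (ha.const_mul ‖L‖).const_mul (M.δ r)
    rw [mul_zero, mul_zero] at hf2
    refine squeeze_zero (fun _ => norm_nonneg _) (fun N => ?_) hf2
    rw [← M.B_sub L (hW N) hV hr.le]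
    refine M.B_norm L (SC_sub (hW N) hV) hr.le (ha0 N) (fun s h0 h1 => ?_)
    rw [hWf, hVf s h0 h1]
    exact hab N (pr s)
  have hcl := isClosed_setOfPred_isCompactOperator (σ₁₂ := RingHom.id ℂ) (M₁ := Y) (M₂ := Y)
  refine hcl.mem_of_tendsto hlim (Eventually.of_forall fun N => ?_)
  change IsCompactOperator (M.Bop L (W N) r)
  rw [M.B_sum L _ (fun k _ => SC_mul (hφ N k) _) hr.le]
  refine isCompactOperator_sum _ _ (fun k _ => ?_)
  rw [M.B_mul L (hφ N k)]
  exact (hK (r * (z N k)) (mul_nonneg hr.le (z N k).2.1)).clm_comp _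

lemma B_compact {U : ℝ → (Y →L[ℂ] Y)} (hU : SC U) (hc : ContinuousOn U (Ioi 0))
    (hK : ∀ t, 0 < t → IsCompactOperator (U t)) {t : ℝ} (ht : 0 < t) :
    IsCompactOperator (M.Bop L U t) := by
  have hcl := isClosed_setOfPred_isCompactOperator (σ₁₂ := RingHom.id ℂ) (M₁ := Y) (M₂ := Y)
  have : M.Bop L U t ∈ closure {f : Y →L[ℂ] Y | IsCompactOperator f} := by
    rw [Metric.mem_closure_iff]
    intro η hη
    obtain ⟨τ, hτ, hτ2⟩ := M.B_shift_approx L hU t hη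
    set ε := min τ (t / 2)
    have hε : 0 < ε := by positivity
    have hε2 : ε ≤ t / 2 := min_le_right _ _
    refine ⟨M.Bop L (fun σ => U (ε + σ)) (t - ε), ?_, ?_⟩
    · exact M.B_compact_aux L (SC_shift hU hε.le) (shift_cont_Ioi hc hε)
        (fun s hs => hK _ (by linarith)) (by linarith)
    · rw [dist_eq_norm]
      exact hτ2 ε hε.le (min_le_left _ _) t (by linarith) le_rfl
  rwa [hcl.closure_eq] at this

end GS


/-- A gauge: `D W C` says that the size of `W` is at most `C`. -/
structure Gauge {E : Type*} [Ring E] (D : E → ℝ → Prop) : Prop where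
  nonneg : ∀ a C, D a C → 0 ≤ C
  mono : ∀ a C C', D a C → C ≤ C' → D a C'
  zero : D 0 0
  add : ∀ a b C C', D a C → D b C' → D (a + b) (C + C')
  neg : ∀ a C, D a C → D (-a) C
  mul : ∀ a b C C', D a C → D b C' → D (a * b) (C * C')

namespace Gauge

variable {E : Type*} [Ring E] {D : E → ℝ → Prop} (G : Gauge D)

lemma sum (G : Gauge D) {ι : Type*} (s : Finset ι) (f : ι → E) (c : ι → ℝ) (h : ∀ i ∈ s, D (f i) (c i)) :
    D (∑ i ∈ s, f i) (∑ i ∈ s, c i) := by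
  classical
  induction s using Finset.induction_on with
  | empty => simpa using G.zero
  | insert a s ha ih =>
    rw [Finset.sum_insert ha, Finset.sum_insert ha]
    exact G.add _ _ _ _ (h a (by simp)) (ih (fun i hi => h i (by simp [hi])))

lemma sum_null (G : Gauge D) {ι : Type*} (s : Finset ι) (f : ι → E) (h : ∀ i ∈ s, D (f i) 0) :
    D (∑ i ∈ s, f i) 0 := by
  simpa using G.sum s f (fun _ => 0) h

lemma sub (G : Gauge D) (a b : E) (C C' : ℝ) (h : D a C) (h' : D b C') : D (a - b) (C + C') := by
  rw [sub_eq_add_neg]; exact G.add _ _ _ _ h (G.neg _ _ h')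

lemma congr (G : Gauge D) {a b : E} {C : ℝ} (h : D a C) (h' : D (b - a) 0) : D b C := by
  have := G.add _ _ _ _ h h'
  rwa [add_sub_cancel, add_zero] at this

lemma nsmul (G : Gauge D) (a : E) (C : ℝ) (h : D a C) (n : ℕ) : D (n • a) (n * C) := by
  induction n with
  | zero => simpa using G.zero
  | succ n ih =>
    rw [succ_nsmul]; push_cast; rw [add_mul, one_mul]
    exact G.add _ _ _ _ ih h

lemma growth (G : Gauge D) (P : ℕ → ℝ → E)
    (hloc : ∀ k b, ∃ C, ∀ t, 0 ≤ t → t ≤ b → D (P k t) C)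
    (hconv : ∀ k t s, 0 ≤ t → 0 ≤ s →
      D (P k (t + s) - ∑ p ∈ Finset.HasAntidiagonal.antidiagonal k, P p.1 t * P p.2 s) 0)
    (w w' : ℝ) (hw : w < w') (h0 : ∃ C, ∀ t, 0 ≤ t → D (P 0 t) (C * Real.exp (w * t))) (k : ℕ) :
    ∃ C, 0 ≤ C ∧ ∀ t, 0 ≤ t → D (P k t) (C * Real.exp (w' * t)) := by
  obtain ⟨C, hC⟩ := h0
  have hC0 : 0 ≤ C := by simpa using G.nonneg _ _ (hC 0 le_rfl)
  have hd : 0 < w' - w := sub_pos.2 hw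
  set τ := (2 * C + 1) / (w' - w) with hτdef
  have hτ : 0 < τ := by positivity
  have hτ2 : C * Real.exp (w * τ) ≤ 1 / 2 * Real.exp (w' * τ) := by
    have e : w' * τ = (2 * C + 1) + w * τ := by rw [hτdef]; field_simp; ring
    rw [e, Real.exp_add, ← mul_assoc]
    refine mul_le_mul_of_nonneg_right ?_ (Real.exp_pos _).le
    linarith [Real.add_one_le_exp (2 * C + 1)]
  induction k using Nat.strong_induction_on with
  | _ k ih =>
  cases k with
  | zero =>
    refine ⟨C, hC0, fun t ht => G.mono _ _ _ (hC t ht) ?_⟩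
    gcongr
  | succ k =>
    choose! c hc0 hc using ih
    choose κ hκ using fun k => hloc k τ
    have hκ0 : ∀ k, 0 ≤ κ k := fun k => G.nonneg _ _ (hκ k 0 le_rfl hτ.le)
    set A := ∑ p ∈ Finset.HasAntidiagonal.antidiagonal k, κ (p.1 + 1) * c p.2 with hA
    have hple : ∀ p ∈ Finset.HasAntidiagonal.antidiagonal k, p.2 < k + 1 := by
      intro p hp
      have := Finset.HasAntidiagonal.mem_antidiagonal.1 hp
      omega
    have hA0 : 0 ≤ A := Finset.sum_nonneg (fun p hp => mul_nonneg (hκ0 _) (hc0 _ (hple p hp)))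
    set K := κ (k + 1) * Real.exp (|w'| * τ) + 2 * A * Real.exp (-(w' * τ)) with hK
    have hK0 : 0 ≤ K := by have := hκ0 (k + 1); positivity
    have main : ∀ m : ℕ, ∀ t, 0 ≤ t → t ≤ (m + 1) * τ → D (P (k + 1) t) (K * Real.exp (w' * t)) := by
      intro m
      induction m with
      | zero =>
        intro t ht htτ
        have htτ : t ≤ τ := by simpa using htτ
        refine G.mono _ _ _ (hκ (k + 1) t ht htτ) ?_
        have h1 : 1 ≤ Real.exp (|w'| * τ) * Real.exp (w' * t) := by
          rw [← Real.exp_add]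
          apply Real.one_le_exp
          have h2 : |w'| * t ≤ |w'| * τ := by gcongr
          have h3 : -|w'| * t ≤ w' * t := by gcongr; exact neg_abs_le w'
          linarith
        have h4 : 0 ≤ 2 * A * Real.exp (-(w' * τ)) * Real.exp (w' * t) := by positivity
        have h5 := mul_le_mul_of_nonneg_left h1 (hκ0 (k + 1))
        rw [hK]
        linarith
      | succ m ihm =>
        intro t ht htm
        rcases le_total t τ with h | h
        · exact ihm t ht (h.trans (by nlinarith [Nat.cast_nonneg (α := ℝ) m]))
        have hs : 0 ≤ t - τ := sub_nonneg.2 h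
        have h1 := ihm (t - τ) hs (by push_cast at htm; linarith)
        have h2 := hconv (k + 1) τ (t - τ) hτ.le hs
        rw [add_sub_cancel] at h2
        refine G.congr ?_ h2
        rw [Finset.Nat.antidiagonal_succ, Finset.sum_cons, Finset.sum_map]
        have h3 : D (∑ p ∈ Finset.HasAntidiagonal.antidiagonal k, P (p.1 + 1) τ * P p.2 (t - τ))
            (A * Real.exp (w' * (t - τ))) := by
          rw [hA, Finset.sum_mul]
          refine G.sum _ _ _ (fun p hp => ?_)
          rw [mul_assoc]
          exact G.mul _ _ _ _ (hκ _ τ hτ.le le_rfl) (hc _ (hple p hp) _ hs)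
        have h4 := G.mul _ _ _ _ (hC τ hτ.le) h1
        refine G.mono _ _ _ (G.add _ _ _ _ h4 h3) ?_
        have e : Real.exp (w' * t) = Real.exp (w' * τ) * Real.exp (w' * (t - τ)) := by
          rw [← Real.exp_add]; congr 1; ring
        rw [e]
        have h5 : A ≤ 1 / 2 * Real.exp (w' * τ) * K := by
          have : Real.exp (w' * τ) * Real.exp (-(w' * τ)) = 1 := by rw [← Real.exp_add]; simp
          have h6 : 0 ≤ 1 / 2 * Real.exp (w' * τ) * (κ (k + 1) * Real.exp (|w'| * τ)) := by
            have := hκ0 (k + 1); positivity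
          have h7 : 1 / 2 * Real.exp (w' * τ) * (2 * A * Real.exp (-(w' * τ))) = A := by
            linear_combination A * this
          rw [hK, mul_add]; linarith
        have hx := (Real.exp_pos (w' * (t - τ))).le
        have h8 : C * Real.exp (w * τ) * (K * Real.exp (w' * (t - τ))) ≤
            1 / 2 * Real.exp (w' * τ) * (K * Real.exp (w' * (t - τ))) := by gcongr
        have h9 := mul_le_mul_of_nonneg_right h5 hx
        linarith
    refine ⟨K, hK0, fun t ht => ?_⟩
    obtain ⟨m, hm⟩ := exists_nat_ge (t / τ)
    refine main m t ht ?_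
    rw [div_le_iff₀ hτ] at hm
    linarith

end Gauge

namespace Gauge

variable {E : Type*} [Ring E] {D : E → ℝ → Prop}

lemma sum_growth (G : Gauge D) (n : ℕ) (P : ℕ → ℝ → E) (w : ℝ)
    (h : ∀ k, ∃ C, 0 ≤ C ∧ ∀ t, 0 ≤ t → D (P k t) (C * Real.exp (w * t))) :
    ∃ C, 0 ≤ C ∧ ∀ t, 0 ≤ t → D (∑ k ∈ Finset.range n, P k t) (C * Real.exp (w * t)) := by
  choose c hc0 hc using h
  refine ⟨∑ k ∈ Finset.range n, c k, Finset.sum_nonneg (fun k _ => hc0 k), fun t ht => ?_⟩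
  rw [Finset.sum_mul]
  exact G.sum _ _ _ (fun k _ => hc k t ht)

lemma forward (G : Gauge D) (S : ℕ → ℝ → E) (R : ℝ → E) (n : ℕ)
    (hloc : ∀ k b, ∃ C, ∀ t, 0 ≤ t → t ≤ b → D (S k t) C)
    (hconv : ∀ k t s, 0 ≤ t → 0 ≤ s →
      S k (t + s) = ∑ p ∈ Finset.HasAntidiagonal.antidiagonal k, S p.1 t * S p.2 s)
    (hR : ∀ t, 0 ≤ t → D (R t - ∑ k ∈ Finset.range n, S k t) 0)
    (w w' : ℝ) (hw : w < w') (h0 : ∃ C, ∀ t, 0 ≤ t → D (S 0 t) (C * Real.exp (w * t))) :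
    ∃ C, 0 ≤ C ∧ ∀ t, 0 ≤ t → D (R t) (C * Real.exp (w' * t)) := by
  obtain ⟨C, hC0, hC⟩ := G.sum_growth n S w' (G.growth S hloc (fun k t s ht hs => by
    rw [hconv k t s ht hs, sub_self]; exact G.zero) w w' hw h0)
  exact ⟨C, hC0, fun t ht => G.congr (hC t ht) (hR t ht)⟩

lemma fiber (n : ℕ) (f : ℕ × ℕ → E) (hf : ∀ p : ℕ × ℕ, n ≤ p.1 ∨ n ≤ p.2 → f p = 0) :
    ∑ k ∈ Finset.range (2 * n), ∑ p ∈ Finset.HasAntidiagonal.antidiagonal k, f p =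
      ∑ p ∈ Finset.range n ×ˢ Finset.range n, f p := by
  rw [← Finset.sum_fiberwise_of_maps_to (s := Finset.range n ×ˢ Finset.range n)
    (t := Finset.range (2 * n)) (g := fun p => p.1 + p.2)]
  · refine Finset.sum_congr rfl (fun k _ => ?_)
    symm
    refine Finset.sum_subset ?_ ?_
    · intro p hp
      rw [Finset.mem_filter] at hp
      exact Finset.HasAntidiagonal.mem_antidiagonal.2 hp.2
    · intro p hp hp2
      apply hf
      have := Finset.HasAntidiagonal.mem_antidiagonal.1 hp
      simp only [Finset.mem_filter, Finset.mem_product, Finset.mem_range] at hp2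
      by_contra hcon
      push Not at hcon
      exact hp2 ⟨hcon, this⟩
  · intro p hp
    simp only [Finset.mem_product, Finset.mem_range] at hp ⊢
    omega

lemma backward (G : Gauge D) (S : ℕ → ℝ → E) (R : ℝ → E) (n : ℕ) (hn : 0 < n)
    (hloc : ∀ k b, ∃ C, ∀ t, 0 ≤ t → t ≤ b → D (S k t) C)
    (hconv : ∀ k t s, 0 ≤ t → 0 ≤ s →
      S k (t + s) = ∑ p ∈ Finset.HasAntidiagonal.antidiagonal k, S p.1 t * S p.2 s)
    (hnull : ∀ k, n ≤ k → ∀ t, 0 ≤ t → D (S k t) 0)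
    (hR : ∀ t, 0 ≤ t → D (R t - ∑ k ∈ Finset.range n, S k t) 0)
    (w w' : ℝ) (hw : w < w') (h0 : ∃ C, ∀ t, 0 ≤ t → D (R t) (C * Real.exp (w * t))) :
    ∃ C, 0 ≤ C ∧ ∀ t, 0 ≤ t → D (S 0 t) (C * Real.exp (w' * t)) := by
  let Z : ℕ → ℝ → E := fun k t => if k < n then S k t else 0
  have hZ : ∀ k t, k < n → Z k t = S k t := fun k t h => if_pos h
  have hZ0 : ∀ k t, n ≤ k → Z k t = 0 := fun k t h => if_neg (not_lt.2 h)
  have hZS : ∀ k t, 0 ≤ t → D (S k t - Z k t) 0 := by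
    intro k t ht
    rcases lt_or_ge k n with h | h
    · rw [hZ k t h, sub_self]; exact G.zero
    · rw [hZ0 k t h, sub_zero]; exact hnull k h t ht
  have hneg : ∀ a, D a 0 → D (-a) 0 := fun a h => G.neg _ _ h
  have hZloc : ∀ k b, ∃ C, ∀ t, 0 ≤ t → t ≤ b → D (Z k t) C := by
    intro k b
    rcases lt_or_ge k n with h | h
    · obtain ⟨C, hC⟩ := hloc k b
      exact ⟨C, fun t h1 h2 => by rw [hZ k t h]; exact hC t h1 h2⟩
    · exact ⟨0, fun t _ _ => by rw [hZ0 k t h]; exact G.zero⟩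
  have hbS : ∀ k t, 0 ≤ t → ∃ C, D (S k t) C := fun k t ht => by
    obtain ⟨C, hC⟩ := hloc k t
    exact ⟨C, hC t ht le_rfl⟩
  have hbZ : ∀ k t, 0 ≤ t → ∃ C, D (Z k t) C := fun k t ht => by
    obtain ⟨C, hC⟩ := hZloc k t
    exact ⟨C, hC t ht le_rfl⟩
  have hZconv : ∀ k t s, 0 ≤ t → 0 ≤ s →
      D (Z k (t + s) - ∑ p ∈ Finset.HasAntidiagonal.antidiagonal k, Z p.1 t * Z p.2 s) 0 := by
    intro k t s ht hs
    have h1 := hneg _ (hZS k (t + s) (add_nonneg ht hs))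
    have h2 : D (∑ p ∈ Finset.HasAntidiagonal.antidiagonal k,
        (S p.1 t * S p.2 s - Z p.1 t * Z p.2 s)) 0 := by
      refine G.sum_null _ _ (fun p _ => ?_)
      have e : S p.1 t * S p.2 s - Z p.1 t * Z p.2 s =
        (S p.1 t - Z p.1 t) * S p.2 s + Z p.1 t * (S p.2 s - Z p.2 s) := by noncomm_ring
      rw [e]
      obtain ⟨C1, hC1⟩ := hbS p.2 s hs
      obtain ⟨C2, hC2⟩ := hbZ p.1 t ht
      have h3 := G.mul _ _ _ _ (hZS p.1 t ht) hC1
      have h4 := G.mul _ _ _ _ hC2 (hZS p.2 s hs)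
      have h5 := G.add _ _ _ _ h3 h4
      simpa using h5
    rw [Finset.sum_sub_distrib, ← hconv k t s ht hs] at h2
    have h3 := G.add _ _ _ _ h1 h2
    rw [add_zero] at h3
    convert h3 using 1
    abel
  let Q : ℕ → ℝ → E := fun j t => ∑ k ∈ Finset.range n, (k.choose j) • Z k t
  have hQ2 : ∀ j t, Q j t = ∑ k ∈ Finset.range (2 * n), (k.choose j) • Z k t := by
    intro j t
    refine Finset.sum_subset (Finset.range_mono (by omega)) (fun k _ hk => ?_)
    rw [hZ0 k t (by simpa using hk), smul_zero]
  have hQloc : ∀ k b, ∃ C, ∀ t, 0 ≤ t → t ≤ b → D (Q k t) C := by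
    intro j b
    choose c hc using fun k => hZloc k b
    exact ⟨_, fun t h1 h2 => G.sum _ _ _ (fun k _ => G.nsmul _ _ (hc k t h1 h2) _)⟩
  have hQprod : ∀ j t s, ∑ p ∈ Finset.HasAntidiagonal.antidiagonal j, Q p.1 t * Q p.2 s =
      ∑ k ∈ Finset.range (2 * n), (k.choose j) • ∑ p ∈ Finset.HasAntidiagonal.antidiagonal k, Z p.1 t * Z p.2 s := by
    intro j t s
    have e1 : ∀ k, (k.choose j) • ∑ p ∈ Finset.HasAntidiagonal.antidiagonal k, Z p.1 t * Z p.2 s =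
        ∑ p ∈ Finset.HasAntidiagonal.antidiagonal k, ((p.1 + p.2).choose j) • (Z p.1 t * Z p.2 s) := by
      intro k
      rw [Finset.smul_sum]
      refine Finset.sum_congr rfl (fun p hp => ?_)
      rw [Finset.HasAntidiagonal.mem_antidiagonal.1 hp]
    rw [Finset.sum_congr rfl (fun k _ => e1 k),
      fiber n (fun p => ((p.1 + p.2).choose j) • (Z p.1 t * Z p.2 s))]
    · have e2 : ∀ p : ℕ × ℕ, ((p.1 + p.2).choose j) • (Z p.1 t * Z p.2 s) =
          ∑ q ∈ Finset.HasAntidiagonal.antidiagonal j,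
            ((p.1.choose q.1) • Z p.1 t) * ((p.2.choose q.2) • Z p.2 s) := by
        intro p
        rw [Nat.add_choose_eq, Finset.sum_smul]
        refine Finset.sum_congr rfl (fun q _ => ?_)
        rw [smul_mul_smul_comm]
      rw [Finset.sum_congr rfl (fun p _ => e2 p), Finset.sum_comm]
      refine Finset.sum_congr rfl (fun q _ => ?_)
      rw [Finset.sum_mul_sum, Finset.sum_product]
    · rintro p (h | h)
      · simp [hZ0 _ _ h]
      · simp [hZ0 _ _ h]
  have hQconv : ∀ j t s, 0 ≤ t → 0 ≤ s →
      D (Q j (t + s) - ∑ p ∈ Finset.HasAntidiagonal.antidiagonal j, Q p.1 t * Q p.2 s) 0 := by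
    intro j t s ht hs
    rw [hQprod, hQ2, ← Finset.sum_sub_distrib]
    refine G.sum_null _ _ (fun k _ => ?_)
    rw [← smul_sub]
    simpa using G.nsmul _ _ (hZconv k t s ht hs) (k.choose j)
  have hQ0 : ∀ t, Q 0 t = ∑ k ∈ Finset.range n, S k t := by
    intro t
    refine Finset.sum_congr rfl (fun k hk => ?_)
    rw [Nat.choose_zero_right, one_smul, hZ k t (by simpa using hk)]
  have hQ00 : ∃ C, ∀ t, 0 ≤ t → D (Q 0 t) (C * Real.exp (w * t)) := by
    obtain ⟨C, hC⟩ := h0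
    refine ⟨C, fun t ht => G.congr (hC t ht) ?_⟩
    rw [hQ0, ← neg_sub]
    exact hneg _ (hR t ht)
  have hgr := G.growth Q hQloc hQconv w w' hw hQ00
  obtain ⟨C, hC0, hC⟩ := G.sum_growth n (fun j t => ((-1 : ℤ) ^ j) • Q j t) w' (fun j => by
    obtain ⟨C, hC0, hC⟩ := hgr j
    refine ⟨C, hC0, fun t ht => ?_⟩
    rcases neg_one_pow_eq_or ℤ j with h | h
    · simpa [h] using hC t ht
    · simpa [h] using G.neg _ _ (hC t ht))
  refine ⟨C, hC0, fun t ht => ?_⟩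
  convert hC t ht using 1
  have e3 : ∀ k ∈ Finset.range n, ∑ j ∈ Finset.range n, ((-1 : ℤ) ^ j * (k.choose j : ℤ)) =
      if k = 0 then 1 else 0 := by
    intro k hk
    rw [← Int.alternating_sum_range_choose]
    symm
    refine Finset.sum_subset (Finset.range_mono (Nat.succ_le_of_lt (Finset.mem_range.1 hk))) (fun j _ hj => ?_)
    rw [Nat.choose_eq_zero_of_lt (by rw [Finset.mem_range] at hj; omega)]
    simp
  have e4 : ∑ j ∈ Finset.range n, ((-1 : ℤ) ^ j) • Q j t =
      ∑ k ∈ Finset.range n, (∑ j ∈ Finset.range n, ((-1 : ℤ) ^ j * (k.choose j : ℤ))) • Z k t := by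
    simp only [Q, Finset.smul_sum, Finset.sum_smul]
    rw [Finset.sum_comm]
    refine Finset.sum_congr rfl (fun k _ => Finset.sum_congr rfl (fun j _ => ?_))
    rw [mul_smul, natCast_zsmul]
  rw [e4, Finset.sum_congr rfl (fun k hk => by rw [e3 k hk])]
  rw [Finset.sum_eq_single_of_mem 0 (by simpa using hn)]
  · simp [hZ 0 t hn]
  · intro k _ hk; simp [hk]

end Gauge

lemma sInf_le_of_loss (A B : Set ℝ) (h : ∀ w ∈ A, ∀ w', w < w' → w' ∈ B) :
    sInf ((fun w : ℝ => (w : EReal)) '' B) ≤ sInf ((fun w : ℝ => (w : EReal)) '' A) := by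
  refine le_sInf ?_
  rintro _ ⟨w, hw, rfl⟩
  refine EReal.le_of_forall_lt_iff_le.1 (fun z hz => ?_)
  exact sInf_le ⟨z, h w hw z (EReal.coe_lt_coe_iff.1 hz), rfl⟩

namespace GS

variable (M : GS X Y) (L : Y →L[ℂ] X)

/-- Operators on which `T` acts norm continuously at `0`. -/
def NC (K : Y →L[ℂ] Y) : Prop := Tendsto (fun h => M.T h * K) (𝓝[>] 0) (𝓝 K)

lemma NC_closed {K : ℕ → (Y →L[ℂ] Y)} {K0 : Y →L[ℂ] Y} (h : Tendsto K atTop (𝓝 K0))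
    (hK : ∀ n, M.NC (K n)) : M.NC K0 := by
  obtain ⟨C, hC0, hC⟩ := M.bdd M.SC_T 1
  unfold NC
  rw [Metric.tendsto_nhds]
  intro ε hε
  have hη : 0 < ε / (C + 2) := by positivity
  obtain ⟨n, hn⟩ := ((Metric.tendsto_nhds.1 h) _ hη).exists
  have h1 := Metric.tendsto_nhds.1 (hK n) _ hη
  have h2 : Ioo (0:ℝ) 1 ∈ 𝓝[>] (0:ℝ) := Ioo_mem_nhdsGT one_pos
  filter_upwards [h1, h2] with s hs hs2
  rw [dist_eq_norm] at hn hs ⊢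
  have e : M.T s * K0 - K0 = (M.T s * K n - K n) - M.T s * (K n - K0) + (K n - K0) := by
    noncomm_ring
  rw [e]
  have h3 : ‖M.T s * (K n - K0)‖ ≤ C * (ε / (C + 2)) :=
    (norm_mul_le _ _).trans (mul_le_mul (hC s hs2.1.le hs2.2.le) hn.le (norm_nonneg _) hC0)
  have h4 : ε / (C + 2) + C * (ε / (C + 2)) + ε / (C + 2) = ε := by field_simp; ring
  calc _ ≤ ‖M.T s * K n - K n‖ + ‖M.T s * (K n - K0)‖ + ‖K n - K0‖ :=
        (norm_add_le _ _).trans (add_le_add (norm_sub_le _ _) le_rfl)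
    _ < _ := by linarith

lemma NC_zero : M.NC 0 := by
  unfold NC; simp

lemma NC_add {K K' : Y →L[ℂ] Y} (h : M.NC K) (h' : M.NC K') : M.NC (K + K') := by
  unfold NC at *
  simpa only [mul_add] using h.add h'

lemma NC_neg {K : Y →L[ℂ] Y} (h : M.NC K) : M.NC (-K) := by
  unfold NC at *
  simpa only [mul_neg] using h.neg

lemma AO_tendsto {U : ℝ → (Y →L[ℂ] Y)} (hA : M.AO U) {t : ℝ} (ht : 0 ≤ t) :
    Tendsto (fun h => U (t + h) - M.T h * U t) (𝓝[>] 0) (𝓝 0) := by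
  obtain ⟨C, hC0, hC⟩ := hA (t + 1)
  have h2 : Ioo (0:ℝ) 1 ∈ 𝓝[>] (0:ℝ) := Ioo_mem_nhdsGT one_pos
  have h3 := M.δ_lim.const_mul C
  rw [mul_zero] at h3
  refine squeeze_zero_norm' ?_ h3
  filter_upwards [h2] with s hs
  exact hC t s ht hs.1.le (by linarith [hs.2])

lemma NC_of_cont {U : ℝ → (Y →L[ℂ] Y)} (hA : M.AO U) (hc : ContinuousOn U (Ioi 0)) {t : ℝ}
    (ht : 0 < t) : M.NC (U t) := by
  have h1 := M.AO_tendsto hA ht.le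
  have h2 : Tendsto (fun h => U (t + h)) (𝓝[>] 0) (𝓝 (U t)) := by
    have h3 : ContinuousAt U t := hc.continuousAt (Ioi_mem_nhds ht)
    have h4 : Tendsto (fun h : ℝ => t + h) (𝓝[>] 0) (𝓝 t) := by
      have : Tendsto (fun h : ℝ => t + h) (𝓝 0) (𝓝 (t + 0)) := by
        exact (continuous_const.add continuous_id).tendsto 0
      rw [add_zero] at this
      exact this.mono_left nhdsWithin_le_nhds
    exact h3.tendsto.comp h4
  have h5 := h2.sub h1
  unfold NC
  simpa using h5

lemma iter_cont {U : ℝ → (Y →L[ℂ] Y)} (hU : SC U) (n : ℕ)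
    (hc : ContinuousOn ((M.Bop L)^[n] U) (Ioi 0)) (k : ℕ) (hk : n ≤ k) :
    ContinuousOn ((M.Bop L)^[k] U) (Ioi 0) := by
  induction k, hk using Nat.le_induction with
  | base => exact hc
  | succ k _ ih =>
    rw [Function.iterate_succ_apply']
    exact M.B_cont L (M.SC_iter L hU k) ih

lemma iter_compact {U : ℝ → (Y →L[ℂ] Y)} (hU : SC U) (hA : M.AO U) (n : ℕ)
    (hc : ∀ t, 0 < t → IsCompactOperator ((M.Bop L)^[n] U t)) (k : ℕ) (hk : n ≤ k) :
    ∀ t, 0 < t → IsCompactOperator ((M.Bop L)^[k] U t) := by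
  induction k, hk using Nat.le_induction with
  | base => exact hc
  | succ k _ ih =>
    rw [Function.iterate_succ_apply']
    exact fun t ht => M.B_compact L (M.SC_iter L hU k)
      (M.cont_of_compact (M.AO_iter L hU hA k) ih) ih ht

lemma iter_zero {U : ℝ → (Y →L[ℂ] Y)} (hU : SC U) (k : ℕ) (hk : 0 < k) :
    (M.Bop L)^[k] U 0 = 0 := by
  obtain ⟨m, rfl⟩ : ∃ m, k = m + 1 := ⟨k - 1, by omega⟩
  rw [Function.iterate_succ_apply']
  exact M.B_zero L (M.SC_iter L hU m)

/-- If a closed additive class of operators contains all late `Sₖ(t)` or all late `Rₖ(t)`,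
it contains both. -/
lemma both_null {R : ℝ → (Y →L[ℂ] Y)} (hR : SC R)
    (hfix : ∀ t ∈ Ici (0:ℝ), R t = M.T t + M.Bop L R t) (N : (Y →L[ℂ] Y) → Prop)
    (N0 : N 0) (Nadd : ∀ a b, N a → N b → N (a + b)) (Nneg : ∀ a, N a → N (-a))
    (Ncl : ∀ (K : ℕ → (Y →L[ℂ] Y)) K0, Tendsto K atTop (𝓝 K0) → (∀ n, N (K n)) → N K0) (n : ℕ)
    (h : (∀ k, n ≤ k → ∀ t, 0 < t → N ((M.Bop L)^[k] M.T t)) ∨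
      (∀ k, n ≤ k → ∀ t, 0 < t → N ((M.Bop L)^[k] R t))) :
    (∀ k, n + 1 ≤ k → ∀ t, 0 ≤ t → N ((M.Bop L)^[k] M.T t)) ∧
      (∀ t, 0 ≤ t → N ((M.Bop L)^[n + 1] R t)) := by
  constructor
  · intro k hk t ht
    rcases ht.eq_or_lt with rfl | ht
    · rw [M.iter_zero L M.SC_T k (by omega)]; exact N0
    rcases h with h | h
    · exact h k (by omega) t ht
    · have := M.iter_R_succ L hR hfix k t ht.le
      rw [← sub_eq_iff_eq_add, sub_eq_add_neg] at this
      rw [← this]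
      exact Nadd _ _ (h k (by omega) t ht) (Nneg _ (h (k + 1) (by omega) t ht))
  · intro t ht
    rcases ht.eq_or_lt with rfl | ht
    · rw [M.iter_zero L hR (n + 1) (by omega)]; exact N0
    rcases h with h | h
    · have hs : ∀ m, N (∑ k ∈ Finset.range m, (M.Bop L)^[n + 1 + k] M.T t) := by
        intro m
        induction m with
        | zero => simpa using N0
        | succ m ih =>
          rw [Finset.sum_range_succ]
          exact Nadd _ _ ih (h _ (by omega) t ht)
      refine Ncl _ _ ?_ hs
      have h1 := (tendsto_add_atTop_iff_nat (n + 1)).2 (M.iter_decay L hR t ht.le)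
      have h2 := (tendsto_const_nhds (x := (M.Bop L)^[n + 1] R t)).sub h1
      rw [sub_zero] at h2
      refine h2.congr (fun m => ?_)
      rw [M.iter_R_sum L hR hfix (n + 1) m t ht.le, add_comm m (n + 1), add_sub_cancel_right]
    · exact h (n + 1) (by omega) t ht

end GS

section infDist

variable {F : Type*} [NormedAddCommGroup F]

lemma le_mul_infDist {S : Set F} (hS : S.Nonempty) {a c : ℝ} (hc : 0 ≤ c) (x : F)
    (h : ∀ y ∈ S, a ≤ c * dist x y) : a ≤ c * Metric.infDist x S := by
  have : Nonempty S := hS.to_subtype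
  rw [Metric.infDist_eq_iInf, Real.mul_iInf_of_nonneg hc]
  exact le_ciInf (fun y => h y y.2)

lemma infDist_add_le {S : Set F} (hS : S.Nonempty) (hadd : ∀ a ∈ S, ∀ b ∈ S, a + b ∈ S) (x y : F) :
    Metric.infDist (x + y) S ≤ Metric.infDist x S + Metric.infDist y S := by
  have h1 : ∀ a ∈ S, Metric.infDist (x + y) S - dist x a ≤ 1 * Metric.infDist y S := by
    intro a ha
    refine le_mul_infDist hS zero_le_one y (fun b hb => ?_)
    have h2 := Metric.infDist_le_dist_of_mem (x := x + y) (hadd a ha b hb)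
    have h3 := dist_add_add_le x y a b
    linarith
  have h2 : Metric.infDist (x + y) S - Metric.infDist y S ≤ 1 * Metric.infDist x S := by
    refine le_mul_infDist hS zero_le_one x (fun a ha => ?_)
    have := h1 a ha
    linarith
  linarith

lemma infDist_neg_le {S : Set F} (hS : S.Nonempty) (hneg : ∀ a ∈ S, -a ∈ S) (x : F) :
    Metric.infDist (-x) S ≤ Metric.infDist x S := by
  have : Metric.infDist (-x) S ≤ 1 * Metric.infDist x S := by
    refine le_mul_infDist hS zero_le_one x (fun a ha => ?_)
    have h2 := Metric.infDist_le_dist_of_mem (x := -x) (hneg a ha)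
    rw [dist_neg_neg] at h2
    linarith
  linarith

end infDist

/-- essential gauge -/
def Dess (W : Y →L[ℂ] Y) (C : ℝ) : Prop :=
  0 ≤ C ∧ Metric.infDist W {K : Y →L[ℂ] Y | IsCompactOperator K} ≤ C

lemma compact_nonempty : Set.Nonempty {K : Y →L[ℂ] Y | IsCompactOperator K} :=
  ⟨0, isCompactOperator_zero⟩

lemma compact_add (a : Y →L[ℂ] Y) (ha : a ∈ {K : Y →L[ℂ] Y | IsCompactOperator K})
    (b : Y →L[ℂ] Y) (hb : b ∈ {K : Y →L[ℂ] Y | IsCompactOperator K}) :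
    a + b ∈ {K : Y →L[ℂ] Y | IsCompactOperator K} := by
  have ha' : IsCompactOperator a := ha
  have hb' : IsCompactOperator b := hb
  exact ha'.add hb'

lemma compact_neg (a : Y →L[ℂ] Y) (ha : a ∈ {K : Y →L[ℂ] Y | IsCompactOperator K}) :
    -a ∈ {K : Y →L[ℂ] Y | IsCompactOperator K} := by
  have ha' : IsCompactOperator a := ha
  exact ha'.neg

lemma Dess_null {K : Y →L[ℂ] Y} (h : IsCompactOperator K) : Dess K 0 :=
  ⟨le_rfl, (Metric.infDist_zero_of_mem (s := {K : Y →L[ℂ] Y | IsCompactOperator K}) h).le⟩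

lemma Dess_norm (K : Y →L[ℂ] Y) : Dess K ‖K‖ := by
  refine ⟨norm_nonneg _, ?_⟩
  have := Metric.infDist_le_dist_of_mem (x := K) (s := {K : Y →L[ℂ] Y | IsCompactOperator K})
    (y := 0) isCompactOperator_zero
  rwa [dist_zero_right] at this

lemma Dess_gauge : Gauge (Dess (Y := Y)) where
  nonneg := fun a C h => h.1
  mono := fun a C C' h hC => ⟨h.1.trans hC, h.2.trans hC⟩
  zero := Dess_null isCompactOperator_zero
  add := fun a b C C' h h' => ⟨add_nonneg h.1 h'.1,
    (infDist_add_le compact_nonempty compact_add a b).trans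
      (add_le_add h.2 h'.2)⟩
  neg := fun a C h => ⟨h.1,
    (infDist_neg_le compact_nonempty compact_neg a).trans h.2⟩
  mul := by
    intro a b C C' h h'
    refine ⟨mul_nonneg h.1 h'.1, ?_⟩
    set S := {K : Y →L[ℂ] Y | IsCompactOperator K} with hS
    have h0 : S.Nonempty := compact_nonempty
    have h1 : ∀ K ∈ S, Metric.infDist (a * b) S ≤ dist a K * Metric.infDist b S := by
      intro K hK
      refine le_mul_infDist h0 dist_nonneg b (fun K' hK' => ?_)
      have h2 : K * b + (a - K) * K' ∈ S := by
        have c1 : IsCompactOperator (K * b : Y →L[ℂ] Y) := IsCompactOperator.comp_clm hK b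
        have c2 : IsCompactOperator ((a - K) * K' : Y →L[ℂ] Y) := IsCompactOperator.clm_comp hK' (a - K)
        exact IsCompactOperator.add c1 c2
      have h3 := Metric.infDist_le_dist_of_mem (x := a * b) h2
      refine h3.trans ?_
      rw [dist_eq_norm, dist_eq_norm, dist_eq_norm]
      have e : a * b - (K * b + (a - K) * K') = (a - K) * (b - K') := by noncomm_ring
      rw [e]
      exact norm_mul_le _ _
    have h2 : Metric.infDist (a * b) S ≤ Metric.infDist b S * Metric.infDist a S := by
      refine le_mul_infDist h0 Metric.infDist_nonneg a (fun K hK => ?_)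
      rw [mul_comm]; exact h1 K hK
    rw [mul_comm] at h2
    exact h2.trans (mul_le_mul h.2 h'.2 Metric.infDist_nonneg h.1)

/-- coordinatewise extension -/
def sqq (W : Y →L[ℂ] Y) : BoundedContinuousFunction ℕ Y →L[ℂ] BoundedContinuousFunction ℕ Y :=
  W.compLeftContinuousBounded ℕ

lemma sqq_add (W V : Y →L[ℂ] Y) (x : BoundedContinuousFunction ℕ Y) :
    sqq (W + V) x = sqq W x + sqq V x := by ext; rfl

lemma sqq_sub (W V : Y →L[ℂ] Y) (x : BoundedContinuousFunction ℕ Y) :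
    sqq (W - V) x = sqq W x - sqq V x := by ext; rfl

lemma sqq_neg (W : Y →L[ℂ] Y) (x : BoundedContinuousFunction ℕ Y) :
    sqq (-W) x = - sqq W x := by ext; rfl

lemma sqq_zero (x : BoundedContinuousFunction ℕ Y) :
    sqq (0 : Y →L[ℂ] Y) x = 0 := by ext; rfl

lemma sqq_one (x : BoundedContinuousFunction ℕ Y) :
    sqq (1 : Y →L[ℂ] Y) x = x := by ext; rfl

lemma sqq_mul (W V : Y →L[ℂ] Y) (x : BoundedContinuousFunction ℕ Y) :
    sqq (W * V) x = sqq W (sqq V x) := by ext; rfl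

lemma sqq_sum {ι : Type*} (s : Finset ι) (W : ι → (Y →L[ℂ] Y)) (x : BoundedContinuousFunction ℕ Y) :
    sqq (∑ i ∈ s, W i) x = ∑ i ∈ s, sqq (W i) x := by
  classical
  induction s using Finset.induction_on with
  | empty => simp [sqq_zero]
  | insert a s ha ih => rw [Finset.sum_insert ha, Finset.sum_insert ha, sqq_add, ih]

lemma sqq_norm (W : Y →L[ℂ] Y) (x : BoundedContinuousFunction ℕ Y) : ‖sqq W x‖ ≤ ‖W‖ * ‖x‖ := by
  rw [BoundedContinuousFunction.norm_le (by positivity)]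
  intro n
  exact (W.le_opNorm _).trans (by gcongr; exact x.norm_coe_le_norm n)

lemma sqq_tendsto {l : Filter ℝ} {W : ℝ → (Y →L[ℂ] Y)} {W0 : Y →L[ℂ] Y} (h : Tendsto W l (𝓝 W0))
    (x : BoundedContinuousFunction ℕ Y) : Tendsto (fun t => sqq (W t) x) l (𝓝 (sqq W0 x)) := by
  rw [tendsto_iff_norm_sub_tendsto_zero] at h ⊢
  have h2 := h.mul_const ‖x‖
  rw [zero_mul] at h2
  refine squeeze_zero (fun _ => norm_nonneg _) (fun t => ?_) h2
  rw [← sqq_sub]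
  exact sqq_norm _ _

/-- critical gauge -/
def Dcrit (N : Submodule ℂ (BoundedContinuousFunction ℕ Y)) (W : Y →L[ℂ] Y) (C : ℝ) : Prop :=
  0 ≤ C ∧ ∀ x, Metric.infDist (sqq W x) (N : Set (BoundedContinuousFunction ℕ Y)) ≤
    C * Metric.infDist x (N : Set (BoundedContinuousFunction ℕ Y))

lemma Dcrit_null (N : Submodule ℂ (BoundedContinuousFunction ℕ Y)) {K : Y →L[ℂ] Y}
    (h : ∀ x, sqq K x ∈ N) : Dcrit N K 0 := by
  refine ⟨le_rfl, fun x => ?_⟩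
  rw [zero_mul]
  exact (Metric.infDist_zero_of_mem (h x)).le

lemma sub_nonempty (N : Submodule ℂ (BoundedContinuousFunction ℕ Y)) :
    (N : Set (BoundedContinuousFunction ℕ Y)).Nonempty := ⟨0, N.zero_mem⟩

lemma Dcrit_norm (N : Submodule ℂ (BoundedContinuousFunction ℕ Y)) {K : Y →L[ℂ] Y}
    (h : ∀ x ∈ N, sqq K x ∈ N) : Dcrit N K ‖K‖ := by
  refine ⟨norm_nonneg _, fun x => ?_⟩
  refine le_mul_infDist (sub_nonempty N) (norm_nonneg _) x (fun y hy => ?_)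
  refine (Metric.infDist_le_dist_of_mem (h y hy)).trans ?_
  rw [dist_eq_norm, dist_eq_norm, ← map_sub]
  exact sqq_norm _ _

lemma Dcrit_gauge (N : Submodule ℂ (BoundedContinuousFunction ℕ Y)) : Gauge (Dcrit N) where
  nonneg := fun a C h => h.1
  mono := fun a C C' h hC => ⟨h.1.trans hC, fun x => (h.2 x).trans
    (mul_le_mul_of_nonneg_right hC Metric.infDist_nonneg)⟩
  zero := Dcrit_null N (fun x => by rw [sqq_zero]; exact N.zero_mem)
  add := fun a b C C' h h' => ⟨add_nonneg h.1 h'.1, fun x => by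
    rw [sqq_add, add_mul]
    exact (infDist_add_le (sub_nonempty N) (fun a ha b hb => N.add_mem ha hb) _ _).trans
      (add_le_add (h.2 x) (h'.2 x))⟩
  neg := fun a C h => ⟨h.1, fun x => by
    rw [sqq_neg]
    exact (infDist_neg_le (sub_nonempty N) (fun a ha => N.neg_mem ha) _).trans (h.2 x)⟩
  mul := fun a b C C' h h' => ⟨mul_nonneg h.1 h'.1, fun x => by
    rw [sqq_mul, mul_assoc]
    exact (h.2 _).trans (mul_le_mul_of_nonneg_left (h'.2 x) h.1)⟩

namespace GS

variable (M : GS X Y) (L : Y →L[ℂ] X)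

lemma two_way {D : (Y →L[ℂ] Y) → ℝ → Prop} (G : Gauge D) {R : ℝ → (Y →L[ℂ] Y)} (hR : SC R)
    (hfix : ∀ t ∈ Ici (0:ℝ), R t = M.T t + M.Bop L R t) (n : ℕ) (hn : 0 < n)
    (hb : ∀ k t, 0 ≤ t → D ((M.Bop L)^[k] M.T t) ‖(M.Bop L)^[k] M.T t‖)
    (h1 : ∀ k, n ≤ k → ∀ t, 0 ≤ t → D ((M.Bop L)^[k] M.T t) 0)
    (h2 : ∀ t, 0 ≤ t → D ((M.Bop L)^[n] R t) 0) (w w' : ℝ) (hw : w < w') :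
    ((∃ C, 0 ≤ C ∧ ∀ t, 0 ≤ t → D (M.T t) (C * Real.exp (w * t))) →
      ∃ C, 0 ≤ C ∧ ∀ t, 0 ≤ t → D (R t) (C * Real.exp (w' * t))) ∧
    ((∃ C, 0 ≤ C ∧ ∀ t, 0 ≤ t → D (R t) (C * Real.exp (w * t))) →
      ∃ C, 0 ≤ C ∧ ∀ t, 0 ≤ t → D (M.T t) (C * Real.exp (w' * t))) := by
  have hloc : ∀ k b, ∃ C, ∀ t, 0 ≤ t → t ≤ b → D ((M.Bop L)^[k] M.T t) C := by
    intro k b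
    obtain ⟨C, hC0, hC⟩ := M.bdd (M.SC_iter L M.SC_T k) b
    exact ⟨C, fun t h0 h1 => G.mono _ _ _ (hb k t h0) (hC t h0 h1)⟩
  have hRS : ∀ t, 0 ≤ t → D (R t - ∑ k ∈ Finset.range n, (M.Bop L)^[k] M.T t) 0 := by
    intro t ht
    have := M.iter_R_sum L hR hfix 0 n t ht
    simp only [zero_add, Function.iterate_zero, id_eq] at this
    rw [this, add_sub_cancel_left]
    exact h2 t ht
  constructor
  · rintro ⟨C, hC0, hC⟩
    exact G.forward (fun k => (M.Bop L)^[k] M.T) R n hloc (fun k t s => M.conv L k t s) hRS w w' hw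
      ⟨C, hC⟩
  · rintro ⟨C, hC0, hC⟩
    exact G.backward (fun k => (M.Bop L)^[k] M.T) R n hn hloc (fun k t s => M.conv L k t s) h1 hRS
      w w' hw ⟨C, hC⟩

lemma ess_main {R : ℝ → (Y →L[ℂ] Y)} (hR : SC R)
    (hfix : ∀ t ∈ Ici (0:ℝ), R t = M.T t + M.Bop L R t)
    (h : (∃ n : ℕ, ∀ t : ℝ, 0 < t → IsCompactOperator ⇑((M.Bop L)^[n] M.T t)) ∨
      (∃ n : ℕ, ∀ t : ℝ, 0 < t → IsCompactOperator ⇑((M.Bop L)^[n] R t))) (w w' : ℝ) (hw : w < w') :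
    ((∃ C, 0 ≤ C ∧ ∀ t, 0 ≤ t → Dess (M.T t) (C * Real.exp (w * t))) →
      ∃ C, 0 ≤ C ∧ ∀ t, 0 ≤ t → Dess (R t) (C * Real.exp (w' * t))) ∧
    ((∃ C, 0 ≤ C ∧ ∀ t, 0 ≤ t → Dess (R t) (C * Real.exp (w * t))) →
      ∃ C, 0 ≤ C ∧ ∀ t, 0 ≤ t → Dess (M.T t) (C * Real.exp (w' * t))) := by
  have hcl := isClosed_setOfPred_isCompactOperator (σ₁₂ := RingHom.id ℂ) (M₁ := Y) (M₂ := Y)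
  have h' : ∃ n : ℕ, (∀ k, n ≤ k → ∀ t, 0 < t → IsCompactOperator ((M.Bop L)^[k] M.T t)) ∨
      (∀ k, n ≤ k → ∀ t, 0 < t → IsCompactOperator ((M.Bop L)^[k] R t)) := by
    rcases h with ⟨n, h⟩ | ⟨n, h⟩
    · exact ⟨n, Or.inl (M.iter_compact L M.SC_T M.AO_T n h)⟩
    · exact ⟨n, Or.inr (M.iter_compact L hR (M.AO_R L hR hfix) n h)⟩
  obtain ⟨n, h'⟩ := h'
  obtain ⟨h1, h2⟩ := M.both_null L hR hfix (fun K => IsCompactOperator K) isCompactOperator_zero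
    (fun a b ha hb => compact_add a ha b hb) (fun a ha => compact_neg a ha)
    (fun K K0 hK hn => hcl.mem_of_tendsto hK (Eventually.of_forall hn)) n h'
  exact M.two_way L Dess_gauge hR hfix (n + 1) (Nat.succ_pos n) (fun k t _ => Dess_norm _)
    (fun k hk t ht => Dess_null (h1 k hk t ht)) (fun t ht => Dess_null (h2 t ht)) w w' hw

lemma B_tendsto_zero {U : ℝ → (Y →L[ℂ] Y)} (hU : SC U) :
    Tendsto (M.Bop L U) (𝓝[>] 0) (𝓝 0) := by
  obtain ⟨C, hC0, hC⟩ := M.bdd hU 1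
  have h2 : Ioo (0:ℝ) 1 ∈ 𝓝[>] (0:ℝ) := Ioo_mem_nhdsGT one_pos
  have h3 := M.δ_lim.mul_const (‖L‖ * C)
  rw [zero_mul] at h3
  refine squeeze_zero_norm' ?_ h3
  filter_upwards [h2] with s hs
  exact M.B_norm L hU hs.1.le hC0 (fun r h0 h1 => hC r h0 (h1.trans hs.2.le))

lemma crit_eq {R : ℝ → (Y →L[ℂ] Y)} (hR : SC R)
    (hfix : ∀ t ∈ Ici (0:ℝ), R t = M.T t + M.Bop L R t) (x : BoundedContinuousFunction ℕ Y) :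
    Tendsto (fun t => sqq (R t) x) (𝓝[>] 0) (𝓝 x) ↔
      Tendsto (fun t => sqq (M.T t) x) (𝓝[>] 0) (𝓝 x) := by
  have h1 := sqq_tendsto (M.B_tendsto_zero L hR) x
  rw [sqq_zero] at h1
  have e : ∀ᶠ t in 𝓝[>] (0:ℝ), sqq (R t) x = sqq (M.T t) x + sqq (M.Bop L R t) x := by
    filter_upwards [self_mem_nhdsWithin] with t ht
    rw [← sqq_add, ← hfix t (mem_Ici.2 (mem_Ioi.1 ht).le)]
  constructor
  · intro h
    have h2 := h.sub h1
    rw [sub_zero] at h2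
    refine h2.congr' ?_
    filter_upwards [e] with t ht
    rw [ht, add_sub_cancel_right]
  · intro h
    have h2 := h.add h1
    rw [add_zero] at h2
    refine h2.congr' ?_
    filter_upwards [e] with t ht
    rw [ht]

variable (N : Submodule ℂ (BoundedContinuousFunction ℕ Y))

lemma NC_mem (hN : ∀ x, x ∈ N ↔ Tendsto (fun t => sqq (M.T t) x) (𝓝[>] 0) (𝓝 x))
    {K : Y →L[ℂ] Y} (hK : M.NC K) (x : BoundedContinuousFunction ℕ Y) : sqq K x ∈ N := by
  rw [hN]
  have := sqq_tendsto hK x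
  simpa only [sqq_mul] using this

lemma S_inv (hN : ∀ x, x ∈ N ↔ Tendsto (fun t => sqq (M.T t) x) (𝓝[>] 0) (𝓝 x))
    (k : ℕ) (t : ℝ) (ht : 0 ≤ t) (x : BoundedContinuousFunction ℕ Y) (hx : x ∈ N) :
    sqq ((M.Bop L)^[k] M.T t) x ∈ N := by
  rw [hN] at hx ⊢
  have h1 := sqq_tendsto (M.AO_tendsto (M.AO_iter L M.SC_T M.AO_T k) ht) x
  rw [sqq_zero] at h1
  have h2 : ∀ j, Tendsto (fun h => sqq ((M.Bop L)^[j] M.T h) x) (𝓝[>] 0)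
      (𝓝 (if j = 0 then x else 0)) := by
    intro j
    cases j with
    | zero => simpa using hx
    | succ j =>
      have := sqq_tendsto (M.B_tendsto_zero L (M.SC_iter L M.SC_T j)) x
      rw [sqq_zero] at this
      simpa only [Function.iterate_succ_apply', Nat.succ_ne_zero, if_false] using this
  have h3 : Tendsto (fun h => ∑ p ∈ Finset.HasAntidiagonal.antidiagonal k,
      sqq ((M.Bop L)^[p.1] M.T t) (sqq ((M.Bop L)^[p.2] M.T h) x)) (𝓝[>] 0)
      (𝓝 (∑ p ∈ Finset.HasAntidiagonal.antidiagonal k,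
        sqq ((M.Bop L)^[p.1] M.T t) (if p.2 = 0 then x else 0))) :=
    tendsto_finsetSum _ (fun p _ => ((sqq ((M.Bop L)^[p.1] M.T t)).continuous.tendsto _).comp (h2 p.2))
  have e : ∑ p ∈ Finset.HasAntidiagonal.antidiagonal k,
        sqq ((M.Bop L)^[p.1] M.T t) (if p.2 = 0 then x else 0) = sqq ((M.Bop L)^[k] M.T t) x := by
    rw [Finset.sum_eq_single_of_mem (k, 0) (Finset.HasAntidiagonal.mem_antidiagonal.2 (by simp))]
    · simp
    · rintro ⟨a, b⟩ hp hne
      have hab := Finset.HasAntidiagonal.mem_antidiagonal.1 hp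
      have : b ≠ 0 := by
        rintro rfl
        apply hne
        simp at hab
        rw [hab]
      simp [this]
  rw [e] at h3
  have h4 := h3.sub h1
  rw [sub_zero] at h4
  refine h4.congr' ?_
  filter_upwards [self_mem_nhdsWithin] with h hh
  have hconv := M.conv L k t h ht (mem_Ioi.1 hh).le
  have e2 : ∑ p ∈ Finset.HasAntidiagonal.antidiagonal k,
      sqq ((M.Bop L)^[p.1] M.T t) (sqq ((M.Bop L)^[p.2] M.T h) x) =
      sqq ((M.Bop L)^[k] M.T (t + h)) x := by
    rw [hconv, sqq_sum]
    exact Finset.sum_congr rfl (fun p _ => (sqq_mul _ _ _).symm)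
  rw [e2, ← sqq_sub, sub_sub_cancel, sqq_mul]

lemma crit_main {R : ℝ → (Y →L[ℂ] Y)} (hR : SC R)
    (hfix : ∀ t ∈ Ici (0:ℝ), R t = M.T t + M.Bop L R t)
    (hN : ∀ x, x ∈ N ↔ Tendsto (fun t => sqq (M.T t) x) (𝓝[>] 0) (𝓝 x))
    (h : (∃ n : ℕ, ContinuousOn ((M.Bop L)^[n] M.T) (Ioi 0)) ∨
      (∃ n : ℕ, ContinuousOn ((M.Bop L)^[n] R) (Ioi 0))) :
    (∀ t, 0 ≤ t → ∀ x ∈ N, sqq (R t) x ∈ N) ∧ ∀ w w' : ℝ, w < w' →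
    ((∃ C, 0 ≤ C ∧ ∀ t, 0 ≤ t → Dcrit N (M.T t) (C * Real.exp (w * t))) →
      ∃ C, 0 ≤ C ∧ ∀ t, 0 ≤ t → Dcrit N (R t) (C * Real.exp (w' * t))) ∧
    ((∃ C, 0 ≤ C ∧ ∀ t, 0 ≤ t → Dcrit N (R t) (C * Real.exp (w * t))) →
      ∃ C, 0 ≤ C ∧ ∀ t, 0 ≤ t → Dcrit N (M.T t) (C * Real.exp (w' * t))) := by
  have h' : ∃ n : ℕ, (∀ k, n ≤ k → ∀ t, 0 < t → M.NC ((M.Bop L)^[k] M.T t)) ∨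
      (∀ k, n ≤ k → ∀ t, 0 < t → M.NC ((M.Bop L)^[k] R t)) := by
    rcases h with ⟨n, h⟩ | ⟨n, h⟩
    · exact ⟨n, Or.inl (fun k hk t ht => M.NC_of_cont (M.AO_iter L M.SC_T M.AO_T k)
        (M.iter_cont L M.SC_T n h k hk) ht)⟩
    · exact ⟨n, Or.inr (fun k hk t ht => M.NC_of_cont (M.AO_iter L hR (M.AO_R L hR hfix) k)
        (M.iter_cont L hR n h k hk) ht)⟩
  obtain ⟨n, h'⟩ := h'
  obtain ⟨h1, h2⟩ := M.both_null L hR hfix M.NC M.NC_zero (fun a b ha hb => M.NC_add ha hb)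
    (fun a ha => M.NC_neg ha) (fun K K0 hK hn => M.NC_closed hK hn) n h'
  refine ⟨fun t ht x hx => ?_, fun w w' hw => ?_⟩
  · have := M.iter_R_sum L hR hfix 0 (n + 1) t ht
    simp only [zero_add, Function.iterate_zero, id_eq] at this
    rw [this, sqq_add, sqq_sum]
    exact N.add_mem (N.sum_mem (fun k _ => M.S_inv L N hN k t ht x hx)) (M.NC_mem N hN (h2 t ht) x)
  · exact M.two_way L (Dcrit_gauge N) hR hfix (n + 1) (Nat.succ_pos n)
      (fun k t ht => Dcrit_norm N (M.S_inv L N hN k t ht))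
      (fun k hk t ht => Dcrit_null N (M.NC_mem N hN (h1 k hk t ht)))
      (fun t ht => Dcrit_null N (M.NC_mem N hN (h2 t ht))) w w' hw

end GS

/-- Forget that the state space is a subspace. -/
def MRSetting.toGS [CompleteSpace X₀] (M : MRSetting X X₀) : GS X X₀ where
  T := M.T
  S := M.S
  T_zero := M.T_zero
  T_add := M.T_add
  T_cont := M.T_cont
  S_zero := M.S_zero
  S_cont := M.S_cont
  TS := M.TS
  δ := M.δ
  δ_nonneg := M.δ_nonneg
  δ_mono := M.δ_mono
  δ_lim := M.δ_lim
  SD := M.SD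
  SD_deriv := M.SD_deriv
  SD_cont := M.SD_cont
  SD_bound := M.SD_bound
  SDop := M.SDop
  SDop_apply := M.SDop_apply

lemma mem_critSub (W : ℝ → (X₀ →L[ℂ] X₀)) (x : BoundedContinuousFunction ℕ X₀) :
    x ∈ critSub W ↔ Tendsto (fun t : ℝ => seqOp (W t) x) (𝓝[>] 0) (𝓝 x) := Iff.rfl

lemma omegaEss_le (U V : ℝ → (X₀ →L[ℂ] X₀))
    (h : ∀ w w' : ℝ, w < w' → (∃ C, 0 ≤ C ∧ ∀ t, 0 ≤ t → Dess (U t) (C * Real.exp (w * t))) →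
      ∃ C, 0 ≤ C ∧ ∀ t, 0 ≤ t → Dess (V t) (C * Real.exp (w' * t))) : omegaEss V ≤ omegaEss U := by
  refine sInf_le_of_loss _ _ ?_
  rintro w ⟨C, hC0, hC⟩ w' hw
  obtain ⟨C', hC'0, hC'⟩ := h w w' hw ⟨C, hC0, fun t ht => ⟨by positivity, hC t ht⟩⟩
  exact ⟨C', hC'0, fun t ht => (hC' t ht).2⟩

lemma omegaCrit_le (U V : ℝ → (X₀ →L[ℂ] X₀)) (N : Submodule ℂ (BoundedContinuousFunction ℕ X₀))
    (hU : critSub U = N) (hV : critSub V = N)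
    (h : ∀ w w' : ℝ, w < w' → (∃ C, 0 ≤ C ∧ ∀ t, 0 ≤ t → Dcrit N (U t) (C * Real.exp (w * t))) →
      ∃ C, 0 ≤ C ∧ ∀ t, 0 ≤ t → Dcrit N (V t) (C * Real.exp (w' * t))) :
    omegaCrit V ≤ omegaCrit U := by
  unfold omegaCrit
  rw [hU, hV]
  refine sInf_le_of_loss _ _ ?_
  rintro w ⟨C, hC0, hC⟩ w' hw
  obtain ⟨C', hC'0, hC'⟩ := h w w' hw ⟨C, hC0, fun t ht => ⟨by positivity, hC t ht⟩⟩
  exact ⟨C', hC'0, fun t ht => (hC' t ht).2⟩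

/-- equality of the essential and critical growth bounds of `T₀` and of the
perturbed semigroup `R₀`, given regularity of some `Sₙ` or `Rₙ` on `(0,∞)`. -/
theorem growth_bound_perturbation (M : MRSetting X X₀) (L : X₀ →L[ℂ] X)
    (R : ℝ → (X₀ →L[ℂ] X₀))
    (hRsc : ∀ x : X₀, ContinuousOn (fun t => R t x) (Ici 0))
    (hRfix : ∀ t ∈ Ici (0:ℝ), R t = M.T t + M.Bop L R t) :
    -- (a)
    (((∃ n : ℕ, ∀ t : ℝ, 0 < t → IsCompactOperator ⇑((M.Bop L)^[n] M.T t)) ∨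
      (∃ n : ℕ, ∀ t : ℝ, 0 < t → IsCompactOperator ⇑((M.Bop L)^[n] R t))) →
      omegaEss R = omegaEss M.T) ∧
    -- (b)
    (((∃ n : ℕ, ContinuousOn ((M.Bop L)^[n] M.T) (Ioi 0)) ∨
      (∃ n : ℕ, ContinuousOn ((M.Bop L)^[n] R) (Ioi 0))) →
      critSub R = critSub M.T ∧
      (∀ t : ℝ, 0 ≤ t → ∀ x ∈ critSub M.T, seqOp (M.T t) x ∈ critSub M.T) ∧
      (∀ t : ℝ, 0 ≤ t → ∀ x ∈ critSub M.T, seqOp (R t) x ∈ critSub M.T) ∧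
      omegaCrit R = omegaCrit M.T) := by
  have : CompleteSpace X₀ := M.closed.completeSpace_coe
  have hR : SC R := hRsc
  have hfix : ∀ t ∈ Ici (0:ℝ), R t = M.toGS.T t + M.toGS.Bop L R t := hRfix
  refine ⟨fun h => ?_, fun h => ?_⟩
  · have key := M.toGS.ess_main L hR hfix h
    exact le_antisymm (omegaEss_le _ _ (fun w w' hw => (key w w' hw).1))
      (omegaEss_le _ _ (fun w w' hw => (key w w' hw).2))
  · have hN : ∀ x, x ∈ critSub M.T ↔ Tendsto (fun t => sqq (M.toGS.T t) x) (𝓝[>] 0) (𝓝 x) :=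
      fun x => mem_critSub M.T x
    have hEq : critSub R = critSub M.T := by
      ext x
      exact M.toGS.crit_eq L hR hfix x
    obtain ⟨hinv, key⟩ := M.toGS.crit_main L (critSub M.T) hR hfix hN h
    refine ⟨hEq, fun t ht x hx => ?_, fun t ht x hx => hinv t ht x hx, ?_⟩
    · exact M.toGS.S_inv L (critSub M.T) hN 0 t ht x hx
    · exact le_antisymm (omegaCrit_le _ _ (critSub M.T) rfl hEq (fun w w' hw => (key w w' hw).1))
        (omegaCrit_le _ _ (critSub M.T) hEq rfl (fun w w' hw => (key w w' hw).2))

end
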